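/- Let T be a near-triangulation of order n ≥ 4 with boundary cycle C, and let v be a vertex of T. Then the graph T − {v}, obtained by deleting v and all its incident edges, is a near-triangulation if and only if either v is an interior vertex of degree 3 in T, or v is a boundary vertex whose degree in the induced subgraph T[C] is 2. -/

import Mathlib

/-!
Common definitions.

A *plane graph* is a finite graph whose vertices are points of the plane `ℝ × ℝ` and whose
edges are drawn as straight-line segments between their endpoints (by Fáry's theorem every
planar graph admits such a drawing).  A *near-triangulation* is a plane graph that is properly
embedded, biconnected, and all of whose bounded faces are triangles (the faces are the
connected components of the complement of the drawing).  The boundary cycle lists, cyclically,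
the vertices on the outer (unbounded) face.
-/

open scoped Classical

noncomputable section

/-- A finite graph drawn in the plane: the vertices are points of `ℝ × ℝ` and each edge is
drawn as the straight-line segment between its endpoints. -/
structure PlaneGraph where
  verts : Finset (ℝ × ℝ)
  Adj : ℝ × ℝ → ℝ × ℝ → Prop
  symm : ∀ p q, Adj p q → Adj q p
  loopless : ∀ p, ¬ Adj p p
  mem_of_adj : ∀ p q, Adj p q → p ∈ verts ∧ q ∈ verts

namespace PlaneGraph

variable (G : PlaneGraph)

/-- The union of the (closed) segments realizing the edges of the graph. -/
def drawing : Set (ℝ × ℝ) := {x | ∃ p q, G.Adj p q ∧ x ∈ segment ℝ p q}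

/-- The straight-line drawing is a proper plane embedding: two edges meet only in common
endpoints and no vertex lies on an edge of which it is not an endpoint. -/
def IsEmbedded : Prop :=
  (∀ p q r s, G.Adj p q → G.Adj r s → ∀ x, x ∈ segment ℝ p q → x ∈ segment ℝ r s →
      ({p, q} : Set (ℝ × ℝ)) = {r, s} ∨
        (x ∈ ({p, q} : Set (ℝ × ℝ)) ∧ x ∈ ({r, s} : Set (ℝ × ℝ)))) ∧
  (∀ p q v, G.Adj p q → v ∈ G.verts → v ∈ segment ℝ p q → v = p ∨ v = q)

/-- Reachability by walks in the graph. -/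
def Reachable (p q : ℝ × ℝ) : Prop := Relation.ReflTransGen G.Adj p q

/-- The graph is connected. -/
def Connected : Prop := G.verts.Nonempty ∧ ∀ p ∈ G.verts, ∀ q ∈ G.verts, G.Reachable p q

/-- Deletion of a set of vertices together with all incident edges. -/
def deleteVerts (S : Finset (ℝ × ℝ)) : PlaneGraph where
  verts := G.verts \ S
  Adj := fun p q => G.Adj p q ∧ p ∉ S ∧ q ∉ S
  symm := fun p q h => ⟨G.symm p q h.1, h.2.2, h.2.1⟩
  loopless := fun p h => G.loopless p h.1
  mem_of_adj := fun p q h => by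
    obtain ⟨h1, h2⟩ := G.mem_of_adj p q h.1
    exact ⟨Finset.mem_sdiff.mpr ⟨h1, h.2.1⟩, Finset.mem_sdiff.mpr ⟨h2, h.2.2⟩⟩

/-- Deletion of a single edge (keeping all vertices). -/
def deleteEdge (p q : ℝ × ℝ) : PlaneGraph where
  verts := G.verts
  Adj := fun a b => G.Adj a b ∧ ¬ ((a = p ∧ b = q) ∨ (a = q ∧ b = p))
  symm := fun a b h => ⟨G.symm a b h.1, by tauto⟩
  loopless := fun a h => G.loopless a h.1
  mem_of_adj := fun a b h => G.mem_of_adj a b h.1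

/-- The (abstract, simple) graph obtained by contracting the edge `(p, q)`:
the vertex `q` is merged into `p`, which becomes the new contracted vertex. -/
def contractEdge (p q : ℝ × ℝ) : PlaneGraph where
  verts := G.verts.erase q
  Adj := fun a b =>
    a ≠ b ∧ a ∈ G.verts.erase q ∧ b ∈ G.verts.erase q ∧
      (G.Adj a b ∨ (a = p ∧ G.Adj q b) ∨ (b = p ∧ G.Adj q a))
  symm := fun a b h => by
    obtain ⟨h1, h2, h3, h4⟩ := h
    refine ⟨h1.symm, h3, h2, ?_⟩
    rcases h4 with h4 | h4 | h4
    · exact Or.inl (G.symm _ _ h4)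
    · exact Or.inr (Or.inr h4)
    · exact Or.inr (Or.inl h4)
  loopless := fun a h => h.1 rfl
  mem_of_adj := fun a b h => ⟨h.2.1, h.2.2.1⟩

/-- Biconnectivity: at least three vertices, connected, and deleting any single vertex leaves
a connected graph. -/
def Biconnected : Prop :=
  3 ≤ G.verts.card ∧ G.Connected ∧ ∀ v ∈ G.verts, (G.deleteVerts {v}).Connected

/-- A face of the plane graph: a connected component of the complement of the drawing. -/
def IsFace (F : Set (ℝ × ℝ)) : Prop :=
  ∃ x, x ∉ G.drawing ∧ F = connectedComponentIn G.drawingᶜ x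

/-- The open triangle with the three given corners. -/
def openTriangle (a b c : ℝ × ℝ) : Set (ℝ × ℝ) :=
  interior (convexHull ℝ ({a, b, c} : Set (ℝ × ℝ)))

/-- Every bounded (inner) face of the drawing is a triangular face of the graph. -/
def InnerFacesTriangles : Prop :=
  ∀ F, G.IsFace F → Bornology.IsBounded F →
    ∃ a ∈ G.verts, ∃ b ∈ G.verts, ∃ c ∈ G.verts,
      G.Adj a b ∧ G.Adj b c ∧ G.Adj a c ∧ F = openTriangle a b c

/-- A near-triangulation: a properly embedded biconnected plane graph all of whose faces are
triangles, except possibly the outer (unbounded) face. -/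
def IsNearTriangulation : Prop :=
  G.IsEmbedded ∧ G.Biconnected ∧ G.InnerFacesTriangles

/-- The outer region: the union of the unbounded components of the complement of the
drawing (for a near-triangulation this is the outer face). -/
def outerRegion : Set (ℝ × ℝ) :=
  {x | x ∉ G.drawing ∧ ¬ Bornology.IsBounded (connectedComponentIn G.drawingᶜ x)}

/-- `u : ZMod h → ℝ × ℝ` is the boundary cycle of `G`: an injective cyclic sequence
`u 0, u 1, …, u (h-1)` of vertices, consecutive ones adjacent, whose edges bound the outer
face and which contains every vertex lying on the boundary of the outer face. -/
def IsBoundaryCycle {h : ℕ} (u : ZMod h → ℝ × ℝ) : Prop :=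
  3 ≤ h ∧ Function.Injective u ∧
  (∀ i, u i ∈ G.verts) ∧
  (∀ i, G.Adj (u i) (u (i + 1))) ∧
  (∀ i, segment ℝ (u i) (u (i + 1)) ⊆ frontier G.outerRegion) ∧
  (∀ v ∈ G.verts, (v : ℝ × ℝ) ∈ frontier G.outerRegion → v ∈ Set.range u)

/-- An interior vertex: a vertex not on the boundary cycle. -/
def IsInteriorVtx {h : ℕ} (u : ZMod h → ℝ × ℝ) (v : ℝ × ℝ) : Prop :=
  v ∈ G.verts ∧ v ∉ Set.range u

/-- The edge `(p, q)` is a diagonal: it joins two non-consecutive boundary vertices. -/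
def IsDiagonalEdge {h : ℕ} (u : ZMod h → ℝ × ℝ) (p q : ℝ × ℝ) : Prop :=
  G.Adj p q ∧ ∃ i j : ZMod h, p = u i ∧ q = u j ∧ j ≠ i + 1 ∧ i ≠ j + 1

/-- The graph has no diagonals: any edge between boundary vertices joins consecutive ones. -/
def HasNoDiagonals {h : ℕ} (u : ZMod h → ℝ × ℝ) : Prop :=
  ∀ i j : ZMod h, G.Adj (u i) (u j) → j = i + 1 ∨ i = j + 1

/-- The degree of a vertex. -/
def degree (v : ℝ × ℝ) : ℕ := (G.verts.filter (fun w => G.Adj v w)).card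

/-- The degree of a vertex in the subgraph induced on the set `S` of vertices. -/
def degreeOn (S : Set (ℝ × ℝ)) (v : ℝ × ℝ) : ℕ :=
  (G.verts.filter (fun w => G.Adj v w ∧ w ∈ S)).card

/-- A total dominating set: every vertex of the graph is adjacent to a member of `D`. -/
def IsTDS (D : Finset (ℝ × ℝ)) : Prop :=
  D ⊆ G.verts ∧ ∀ v ∈ G.verts, ∃ d ∈ D, G.Adj v d

/-- The total domination number `γₜ`. -/
def totalDominationNumber : ℕ :=
  sInf {k | ∃ D : Finset (ℝ × ℝ), G.IsTDS D ∧ D.card = k}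

/-- Isomorphism of plane graphs as abstract graphs. -/
def IsIsoTo (H : PlaneGraph) : Prop :=
  ∃ f : ℝ × ℝ → ℝ × ℝ,
    Set.BijOn f (↑G.verts) (↑H.verts) ∧
    ∀ p ∈ G.verts, ∀ q ∈ G.verts, (G.Adj p q ↔ H.Adj (f p) (f q))

/-- The edge `(p, q)` is contractible: the contracted graph `G/e` is (abstractly isomorphic
to) a near-triangulation. -/
def IsContractible (p q : ℝ × ℝ) : Prop :=
  G.Adj p q ∧ ∃ H : PlaneGraph, H.IsNearTriangulation ∧ (G.contractEdge p q).IsIsoTo H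

/-- A separating triangle: a triangle of the graph with some vertex strictly inside it and
some vertex outside it. -/
def IsSeparatingTriangle (a b c : ℝ × ℝ) : Prop :=
  a ∈ G.verts ∧ b ∈ G.verts ∧ c ∈ G.verts ∧
  G.Adj a b ∧ G.Adj b c ∧ G.Adj a c ∧
  (∃ v ∈ G.verts, v ∈ openTriangle a b c) ∧
  (∃ v ∈ G.verts, v ∉ convexHull ℝ ({a, b, c} : Set (ℝ × ℝ)))

/-- Edge list of the first exceptional 12-vertex maximal outerplanar graph `H₁`
(boundary 12-cycle, central triangle `{0,4,8}`, ear triangles `{1,2,3}`, `{5,6,7}`,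
`{9,10,11}`, and the three remaining quadrilateral diagonals, all with the same
orientation). -/
def exc1Edges : List (Fin 12 × Fin 12) :=
  [(0,1),(1,2),(2,3),(3,4),(4,5),(5,6),(6,7),(7,8),(8,9),(9,10),(10,11),(11,0),
   (0,4),(4,8),(0,8),(1,3),(5,7),(9,11),(0,3),(4,7),(8,11)]

/-- Edge list of the second exceptional 12-vertex maximal outerplanar graph `H₂`
(same as `H₁` except that one quadrilateral diagonal has the opposite orientation). -/
def exc2Edges : List (Fin 12 × Fin 12) :=
  [(0,1),(1,2),(2,3),(3,4),(4,5),(5,6),(6,7),(7,8),(8,9),(9,10),(10,11),(11,0),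
   (0,4),(4,8),(0,8),(1,3),(5,7),(9,11),(0,3),(4,7),(0,9)]

/-- The exceptional graph `H₁`. -/
def H1graph : SimpleGraph (Fin 12) := SimpleGraph.fromRel (fun a b => (a, b) ∈ exc1Edges)

/-- The exceptional graph `H₂`. -/
def H2graph : SimpleGraph (Fin 12) := SimpleGraph.fromRel (fun a b => (a, b) ∈ exc2Edges)

/-- Isomorphism between a plane graph and a simple graph on `Fin 12`. -/
def IsIsoToSG (H : SimpleGraph (Fin 12)) : Prop :=
  ∃ f : ℝ × ℝ → Fin 12,
    Set.BijOn f (↑G.verts) Set.univ ∧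
    ∀ p ∈ G.verts, ∀ q ∈ G.verts, (G.Adj p q ↔ H.Adj (f p) (f q))

/-- `G` is isomorphic to `H₁` or to `H₂`. -/
def IsExceptional : Prop := G.IsIsoToSG H1graph ∨ G.IsIsoToSG H2graph

/-- A maximal outerplanar graph (MOP): a near-triangulation all of whose vertices lie on the
boundary cycle. -/
def IsMOP : Prop :=
  G.IsNearTriangulation ∧
    ∃ (h : ℕ) (u : ZMod h → ℝ × ℝ), G.IsBoundaryCycle u ∧ ∀ v ∈ G.verts, v ∈ Set.range u

/-- The graph is Hamiltonian: it has a cycle through all of its vertices. -/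
def IsHamiltonian : Prop :=
  ∃ (m : ℕ) (c : ZMod m → ℝ × ℝ), 3 ≤ m ∧ Function.Injective c ∧
    (∀ i, G.Adj (c i) (c (i + 1))) ∧ ∀ v ∈ G.verts, v ∈ Set.range c

/-- An outerplane graph: a properly embedded plane graph all of whose vertices lie on the
boundary of the outer region. -/
def IsOuterplane : Prop :=
  G.IsEmbedded ∧ ∀ v ∈ G.verts, (v : ℝ × ℝ) ∈ closure G.outerRegion

/-- The union of the boundary-cycle segments. -/
def boundaryDrawing {h : ℕ} (u : ZMod h → ℝ × ℝ) : Set (ℝ × ℝ) :=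
  ⋃ i : ZMod h, segment ℝ (u i) (u (i + 1))

/-- The open interior of the boundary cycle, viewed as a simple closed polygon. -/
def polygonInterior {h : ℕ} (u : ZMod h → ℝ × ℝ) : Set (ℝ × ℝ) :=
  {x | x ∉ boundaryDrawing u ∧
    Bornology.IsBounded (connectedComponentIn (boundaryDrawing u)ᶜ x)}

/-- The union of the segments realizing the diagonals of `G[C]`. -/
def diagonalDrawing {h : ℕ} (u : ZMod h → ℝ × ℝ) : Set (ℝ × ℝ) :=
  {x | ∃ i j : ZMod h, G.Adj (u i) (u j) ∧ j ≠ i + 1 ∧ i ≠ j + 1 ∧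
    x ∈ segment ℝ (u i) (u j)}

/-- A region of the subdivision of the interior of the boundary cycle by the diagonals of
`G[C]`: a connected component of the interior of the cycle minus the diagonals. -/
def IsSubdivisionRegion {h : ℕ} (u : ZMod h → ℝ × ℝ) (R : Set (ℝ × ℝ)) : Prop :=
  ∃ x ∈ polygonInterior u \ G.diagonalDrawing u,
    R = connectedComponentIn (polygonInterior u \ G.diagonalDrawing u) x

/-- The diagonal `(u i, u j)` is a side of the region `R`. -/
def IsSideOf {h : ℕ} (u : ZMod h → ℝ × ℝ) (R : Set (ℝ × ℝ)) (i j : ZMod h) : Prop :=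
  G.Adj (u i) (u j) ∧ j ≠ i + 1 ∧ i ≠ j + 1 ∧
    segment ℝ (u i) (u j) \ {u i, u j} ⊆ frontier R

/-- `v` lies on the opposite side of the diagonal `(u i, u j)` from the region `R`:
inside the boundary polygon, `v` cannot be joined to `R` without crossing the diagonal. -/
def OppositeSideOf {h : ℕ} (u : ZMod h → ℝ × ℝ) (R : Set (ℝ × ℝ)) (i j : ZMod h)
    (v : ℝ × ℝ) : Prop :=
  ∀ x ∈ R, v ∉ connectedComponentIn (polygonInterior u \ segment ℝ (u i) (u j)) x

/-- A terminal polygon: a region of the subdivision containing some interior vertex such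
that at most one of its sides has interior vertices of `G` on its opposite side
(i.e. at most one of the outer parts `T_out(P,d)` contains interior vertices). -/
def IsTerminalPolygon {h : ℕ} (u : ZMod h → ℝ × ℝ) (R : Set (ℝ × ℝ)) : Prop :=
  G.IsSubdivisionRegion u R ∧
  (∃ v, G.IsInteriorVtx u v ∧ v ∈ R) ∧
  ∀ i j k l : ZMod h,
    G.IsSideOf u R i j → G.IsSideOf u R k l →
    (∃ w, G.IsInteriorVtx u w ∧ OppositeSideOf u R i j w) →
    (∃ w, G.IsInteriorVtx u w ∧ OppositeSideOf u R k l w) →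
    ({u i, u j} : Set (ℝ × ℝ)) = {u k, u l}

/-- An irreducible near-triangulation: it has interior vertices, and for every boundary edge
`(u i, u (i+1))` the third vertex of the inner triangular face containing this edge also lies
on the boundary cycle. -/
def Irreducible {h : ℕ} (u : ZMod h → ℝ × ℝ) : Prop :=
  (∃ v, G.IsInteriorVtx u v) ∧
  ∀ i : ZMod h, ∀ v ∈ G.verts,
    G.Adj (u i) v → G.Adj (u (i + 1)) v →
    G.IsFace (openTriangle (u i) (u (i + 1)) v) → v ∈ Set.range u

end PlaneGraph

namespace PlaneGraph

variable {G : PlaneGraph}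

/-- Twice the signed area of the triangle `abc`. -/
def cross (a b c : ℝ × ℝ) : ℝ := (b.1 - a.1) * (c.2 - a.2) - (b.2 - a.2) * (c.1 - a.1)

lemma cross_rotate (a b c : ℝ × ℝ) : cross b c a = cross a b c := by
  unfold cross; ring

lemma cross_swap (a b c : ℝ × ℝ) : cross b a c = -cross a b c := by
  unfold cross; ring

lemma cross_self_right (a b : ℝ × ℝ) : cross a b b = 0 := by
  unfold cross; ring

lemma cross_self_outer (a b : ℝ × ℝ) : cross a b a = 0 := by
  unfold cross; ring

lemma continuous_cross (a b : ℝ × ℝ) : Continuous (cross a b) := by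
  unfold cross; fun_prop

lemma cross_eq_zero_of_mem_segment {a b x : ℝ × ℝ} (hx : x ∈ segment ℝ a b) :
    cross a b x = 0 := by
  rw [segment_eq_image'] at hx
  obtain ⟨t, -, rfl⟩ := hx
  simp [cross]; ring

lemma mem_convexHull_triple {a b c x : ℝ × ℝ} :
    x ∈ convexHull ℝ ({a, b, c} : Set (ℝ × ℝ)) ↔
      ∃ α β γ : ℝ, 0 ≤ α ∧ 0 ≤ β ∧ 0 ≤ γ ∧ α + β + γ = 1 ∧ x = α • a + β • b + γ • c := by
  constructor
  · intro hx
    rw [convexHull_insert (by simp), convexHull_pair, mem_convexJoin] at hx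
    obtain ⟨a', ha', y, ⟨β, γ, hβ, hγ, hs, rfl⟩, ⟨p, q, hp, hq, hpq, rfl⟩⟩ := hx
    obtain rfl : a' = a := ha'
    refine ⟨p, q * β, q * γ, hp, by positivity, by positivity, ?_, ?_⟩
    · rw [← hpq, add_assoc, ← mul_add, hs, mul_one]
    · simp only [smul_add, smul_smul, add_assoc]
  · rintro ⟨α, β, γ, hα, hβ, hγ, hs, rfl⟩
    have hconv := convex_convexHull ℝ ({a, b, c} : Set (ℝ × ℝ))
    have := hconv.sum_mem (t := Finset.univ) (w := ![α, β, γ]) (z := ![a, b, c])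
      (by intro i _; fin_cases i <;> simpa)
      (by simp [Fin.sum_univ_three, hs])
      (by
        intro i _
        apply subset_convexHull
        fin_cases i <;> simp)
    simpa [Fin.sum_univ_three] using this

lemma mem_convexHull_iff_cross {a b c : ℝ × ℝ} (h : 0 < cross a b c) (x : ℝ × ℝ) :
    x ∈ convexHull ℝ ({a, b, c} : Set (ℝ × ℝ)) ↔
      0 ≤ cross a b x ∧ 0 ≤ cross b c x ∧ 0 ≤ cross c a x := by
  rw [mem_convexHull_triple]
  constructor
  · rintro ⟨α, β, γ, hα, hβ, hγ, hs, rfl⟩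
    obtain rfl : α = 1 - β - γ := by linarith
    have h1 : cross a b ((1 - β - γ) • a + β • b + γ • c) = γ * cross a b c := by
      simp [cross]; ring
    have h2 : cross b c ((1 - β - γ) • a + β • b + γ • c) = (1 - β - γ) * cross a b c := by
      simp [cross]; ring
    have h3 : cross c a ((1 - β - γ) • a + β • b + γ • c) = β * cross a b c := by
      simp [cross]; ring
    rw [h1, h2, h3]
    refine ⟨?_, ?_, ?_⟩ <;> positivity
  · rintro ⟨h1, h2, h3⟩
    refine ⟨cross b c x / cross a b c, cross c a x / cross a b c, cross a b x / cross a b c,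
      by positivity, by positivity, by positivity, ?_, ?_⟩
    · field_simp
      simp [cross]; ring
    · ext
      · simp; field_simp; simp [cross]; ring
      · simp; field_simp; simp [cross]; ring

lemma exists_pos_add_smul_mem {s : Set (ℝ × ℝ)} {x : ℝ × ℝ} (hx : s ∈ nhds x) (d : ℝ × ℝ) :
    ∃ ε : ℝ, 0 < ε ∧ ∀ r : ℝ, 0 ≤ r → r ≤ ε → x + r • d ∈ s := by
  have hc : Continuous fun r : ℝ => x + r • d := by fun_prop
  have := hc.continuousAt.preimage_mem_nhds (x := 0) (t := s) (by simpa using hx)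
  obtain ⟨ε, hε, hs⟩ := Metric.mem_nhds_iff.1 this
  refine ⟨ε / 2, by positivity, fun r h0 h1 => hs ?_⟩
  rw [Metric.mem_ball, Real.dist_eq, sub_zero, abs_of_nonneg h0]
  linarith

lemma interior_cross_nonneg {a b x : ℝ × ℝ} {s : Set (ℝ × ℝ)} (hab : a ≠ b)
    (hs : ∀ y ∈ s, 0 ≤ cross a b y) (hx : x ∈ interior s) : 0 < cross a b x := by
  obtain ⟨ε, hε, h⟩ := exists_pos_add_smul_mem (mem_interior_iff_mem_nhds.1 hx)
    (b.2 - a.2, -(b.1 - a.1))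
  have h1 := hs _ (h ε hε.le le_rfl)
  have h2 : cross a b (x + ε • (b.2 - a.2, -(b.1 - a.1))) =
      cross a b x - ε * ((b.1 - a.1) ^ 2 + (b.2 - a.2) ^ 2) := by
    simp [cross]; ring
  have h3 : 0 < (b.1 - a.1) ^ 2 + (b.2 - a.2) ^ 2 := by
    by_contra! hle
    apply hab
    ext
    · nlinarith [sq_nonneg (b.1 - a.1), sq_nonneg (b.2 - a.2)]
    · nlinarith [sq_nonneg (b.1 - a.1), sq_nonneg (b.2 - a.2)]
  have := mul_pos hε h3
  linarith

lemma ne_of_cross_pos {a b c : ℝ × ℝ} (h : 0 < cross a b c) : a ≠ b := by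
  rintro rfl
  simp [cross] at h

lemma mem_openTriangle_iff {a b c : ℝ × ℝ} (h : 0 < cross a b c) (x : ℝ × ℝ) :
    x ∈ openTriangle a b c ↔ 0 < cross a b x ∧ 0 < cross b c x ∧ 0 < cross c a x := by
  have hb : 0 < cross b c a := by rwa [cross_rotate]
  have hc : 0 < cross c a b := by rwa [cross_rotate, cross_rotate]
  constructor
  · intro hx
    have key := fun y hy => (mem_convexHull_iff_cross h y).1 hy
    exact ⟨interior_cross_nonneg (ne_of_cross_pos h) (fun y hy => (key y hy).1) hx,
      interior_cross_nonneg (ne_of_cross_pos hb) (fun y hy => (key y hy).2.1) hx,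
      interior_cross_nonneg (ne_of_cross_pos hc) (fun y hy => (key y hy).2.2) hx⟩
  · intro hx
    refine interior_maximal (t := {y | 0 < cross a b y ∧ 0 < cross b c y ∧ 0 < cross c a y})
      (fun y hy => (mem_convexHull_iff_cross h y).2 ⟨hy.1.le, hy.2.1.le, hy.2.2.le⟩) ?_ hx
    exact (isOpen_lt continuous_const (continuous_cross a b)).inter
      ((isOpen_lt continuous_const (continuous_cross b c)).inter
        (isOpen_lt continuous_const (continuous_cross c a)))

lemma cross_ne_zero_of_mem_openTriangle {a b c x : ℝ × ℝ} (hx : x ∈ openTriangle a b c) :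
    cross a b c ≠ 0 := by
  intro h0
  have key : ∀ y ∈ convexHull ℝ ({a, b, c} : Set (ℝ × ℝ)),
      ∀ z ∈ convexHull ℝ ({a, b, c} : Set (ℝ × ℝ)),
      ∀ w ∈ convexHull ℝ ({a, b, c} : Set (ℝ × ℝ)), cross y z w = 0 := by
    intro y hy z hz w hw
    rw [mem_convexHull_triple] at hy hz hw
    obtain ⟨α, β, γ, -, -, -, hs, rfl⟩ := hy
    obtain ⟨α', β', γ', -, -, -, hs', rfl⟩ := hz
    obtain ⟨α'', β'', γ'', -, -, -, hs'', rfl⟩ := hw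
    obtain rfl : α = 1 - β - γ := by linarith
    obtain rfl : α' = 1 - β' - γ' := by linarith
    obtain rfl : α'' = 1 - β'' - γ'' := by linarith
    have : cross ((1 - β - γ) • a + β • b + γ • c) ((1 - β' - γ') • a + β' • b + γ' • c)
        ((1 - β'' - γ'') • a + β'' • b + γ'' • c) =
        ((β' - β) * (γ'' - γ) - (γ' - γ) * (β'' - β)) * cross a b c := by
      simp [cross]; ring
    rw [this, h0, mul_zero]
  have hn := mem_interior_iff_mem_nhds.1 hx
  obtain ⟨ε, hε, h1⟩ := exists_pos_add_smul_mem hn (1, 0)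
  obtain ⟨δ, hδ, h2⟩ := exists_pos_add_smul_mem hn (0, 1)
  have := key x (interior_subset hx) _ (h1 ε hε.le le_rfl) _ (h2 δ hδ.le le_rfl)
  simp [cross] at this
  rcases this with h | h <;> linarith

lemma openTriangle_swap (a b c : ℝ × ℝ) : openTriangle b a c = openTriangle a b c := by
  unfold openTriangle; rw [Set.insert_comm]

lemma openTriangle_rotate (a b c : ℝ × ℝ) : openTriangle b c a = openTriangle a b c := by
  unfold openTriangle
  congr 2
  ext x; simp; tauto

lemma convex_openTriangle (a b c : ℝ × ℝ) : Convex ℝ (openTriangle a b c) :=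
  (convex_convexHull ℝ _).interior

lemma isOpen_openTriangle (a b c : ℝ × ℝ) : IsOpen (openTriangle a b c) := isOpen_interior

lemma isClosed_convexHull_triple (a b c : ℝ × ℝ) :
    IsClosed (convexHull ℝ ({a, b, c} : Set (ℝ × ℝ))) :=
  ((Set.toFinite _).isCompact_convexHull (𝕜 := ℝ)).isClosed

lemma isBounded_openTriangle (a b c : ℝ × ℝ) : Bornology.IsBounded (openTriangle a b c) :=
  ((Set.toFinite ({a, b, c} : Set (ℝ × ℝ))).isCompact_convexHull (𝕜 := ℝ)).isBounded.subset
    interior_subset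

lemma closure_openTriangle_subset (a b c : ℝ × ℝ) :
    closure (openTriangle a b c) ⊆ convexHull ℝ ({a, b, c} : Set (ℝ × ℝ)) :=
  closure_minimal interior_subset (isClosed_convexHull_triple a b c)

lemma subset_closure_openTriangle {a b c : ℝ × ℝ} (h : (openTriangle a b c).Nonempty) :
    convexHull ℝ ({a, b, c} : Set (ℝ × ℝ)) ⊆ closure (openTriangle a b c) := by
  have := (convex_convexHull ℝ
    ({a, b, c} : Set (ℝ × ℝ))).closure_interior_eq_closure_of_nonempty_interior h
  unfold openTriangle
  rw [this]
  exact subset_closure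

lemma mem_segment_of_cross {a b c x : ℝ × ℝ} (h : 0 < cross a b c) (h1 : cross a b x = 0)
    (h2 : 0 ≤ cross b c x) (h3 : 0 ≤ cross c a x) : x ∈ segment ℝ a b := by
  refine ⟨cross b c x / cross a b c, cross c a x / cross a b c, by positivity, by positivity,
    ?_, ?_⟩
  · field_simp
    have : cross a b x + cross b c x + cross c a x = cross a b c := by simp [cross]; ring
    linarith
  · have e1 : cross b c x * a.1 + cross c a x * b.1 + cross a b x * c.1 = x.1 * cross a b c := by
      simp [cross]; ring
    have e2 : cross b c x * a.2 + cross c a x * b.2 + cross a b x * c.2 = x.2 * cross a b c := by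
      simp [cross]; ring
    ext
    · simp; field_simp; linarith [h1 ▸ e1]
    · simp; field_simp; linarith [h1 ▸ e2]

lemma openTriangle_boundary_of_cross_pos {a b c x : ℝ × ℝ} (h : 0 < cross a b c)
    (hx : x ∈ convexHull ℝ ({a, b, c} : Set (ℝ × ℝ))) (hx' : x ∉ openTriangle a b c) :
    x ∈ segment ℝ a b ∨ x ∈ segment ℝ b c ∨ x ∈ segment ℝ a c := by
  rw [mem_openTriangle_iff h] at hx'
  obtain ⟨h1, h2, h3⟩ := (mem_convexHull_iff_cross h x).1 hx
  have hb : 0 < cross b c a := by rwa [cross_rotate]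
  have hc : 0 < cross c a b := by rwa [cross_rotate, cross_rotate]
  rcases h1.eq_or_lt with e | e1
  · exact Or.inl (mem_segment_of_cross h e.symm h2 h3)
  rcases h2.eq_or_lt with e | e2
  · exact Or.inr (Or.inl (mem_segment_of_cross hb e.symm h3 h1))
  rcases h3.eq_or_lt with e | e3
  · exact Or.inr (Or.inr (segment_symm ℝ a c ▸ mem_segment_of_cross hc e.symm h1 h2))
  · exact absurd ⟨e1, e2, e3⟩ hx'

lemma openTriangle_boundary {a b c x : ℝ × ℝ} (hne : (openTriangle a b c).Nonempty)
    (hx : x ∈ closure (openTriangle a b c)) (hx' : x ∉ openTriangle a b c) :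
    x ∈ segment ℝ a b ∨ x ∈ segment ℝ b c ∨ x ∈ segment ℝ a c := by
  obtain ⟨y, hy⟩ := hne
  rcases (cross_ne_zero_of_mem_openTriangle hy).lt_or_gt with h | h
  · rw [← openTriangle_swap] at hx hx'
    have := openTriangle_boundary_of_cross_pos (a := b) (b := a) (c := c)
      (by rw [cross_swap]; linarith) (closure_openTriangle_subset _ _ _ hx) hx'
    rw [segment_symm ℝ b a] at this
    tauto
  · exact openTriangle_boundary_of_cross_pos h (closure_openTriangle_subset _ _ _ hx) hx'

lemma isCompact_drawing (G : PlaneGraph) : IsCompact G.drawing := by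
  have h : G.drawing =
      ⋃ e ∈ (G.verts ×ˢ G.verts).filter (fun e => G.Adj e.1 e.2), segment ℝ e.1 e.2 := by
    ext x
    rw [Set.mem_iUnion₂]
    constructor
    · rintro ⟨p, q, hpq, hx⟩
      exact ⟨(p, q), Finset.mem_filter.2 ⟨Finset.mem_product.2 (G.mem_of_adj p q hpq), hpq⟩, hx⟩
    · rintro ⟨⟨p, q⟩, hpq, hx⟩
      exact ⟨p, q, (Finset.mem_filter.1 hpq).2, hx⟩
  rw [h]
  refine (Finset.finite_toSet _).isCompact_biUnion fun e _ => ?_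
  rw [← convexHull_pair]
  exact (Set.toFinite _).isCompact_convexHull (𝕜 := ℝ)

lemma isOpen_compl_drawing (G : PlaneGraph) : IsOpen G.drawingᶜ :=
  G.isCompact_drawing.isClosed.isOpen_compl

lemma left_mem_drawing {p q : ℝ × ℝ} (h : G.Adj p q) : p ∈ G.drawing :=
  ⟨p, q, h, left_mem_segment ℝ p q⟩

lemma segment_subset_drawing {p q : ℝ × ℝ} (h : G.Adj p q) : segment ℝ p q ⊆ G.drawing :=
  fun _ hx => ⟨p, q, h, hx⟩

lemma isFace_component {x : ℝ × ℝ} (hx : x ∉ G.drawing) :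
    G.IsFace (connectedComponentIn G.drawingᶜ x) := ⟨x, hx, rfl⟩

lemma IsFace.eq_component {F : Set (ℝ × ℝ)} {x : ℝ × ℝ} (hF : G.IsFace F) (hx : x ∈ F) :
    F = connectedComponentIn G.drawingᶜ x := by
  obtain ⟨y, -, rfl⟩ := hF
  exact connectedComponentIn_eq hx

lemma IsFace.isOpen {F : Set (ℝ × ℝ)} (hF : G.IsFace F) : IsOpen F := by
  obtain ⟨y, -, rfl⟩ := hF
  exact G.isOpen_compl_drawing.connectedComponentIn

lemma IsFace.notMem_drawing {F : Set (ℝ × ℝ)} {x : ℝ × ℝ} (hF : G.IsFace F) (hx : x ∈ F) :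
    x ∉ G.drawing := by
  obtain ⟨y, -, rfl⟩ := hF
  exact connectedComponentIn_subset _ _ hx

lemma IsFace.nonempty {F : Set (ℝ × ℝ)} (hF : G.IsFace F) : F.Nonempty := by
  obtain ⟨y, hy, rfl⟩ := hF
  exact ⟨y, mem_connectedComponentIn hy⟩

lemma IsFace.isPreconnected {F : Set (ℝ × ℝ)} (hF : G.IsFace F) : IsPreconnected F := by
  obtain ⟨y, -, rfl⟩ := hF
  exact isPreconnected_connectedComponentIn

lemma IsFace.subset_of_isPreconnected {F S : Set (ℝ × ℝ)} {x : ℝ × ℝ} (hF : G.IsFace F)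
    (hS : IsPreconnected S) (hSd : Disjoint S G.drawing) (hxS : x ∈ S) (hxF : x ∈ F) :
    S ⊆ F := by
  rw [hF.eq_component hxF]
  exact hS.subset_connectedComponentIn hxS (Set.disjoint_left.1 hSd)

lemma mem_outerRegion_of_component_eq {x y : ℝ × ℝ} (hx : x ∈ G.outerRegion)
    (hy : y ∈ connectedComponentIn G.drawingᶜ x) : y ∈ G.outerRegion := by
  refine ⟨connectedComponentIn_subset _ _ hy, ?_⟩
  rw [← connectedComponentIn_eq hy]
  exact hx.2

lemma isOpen_outerRegion (G : PlaneGraph) : IsOpen G.outerRegion := by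
  rw [isOpen_iff_mem_nhds]
  intro x hx
  exact Filter.mem_of_superset
    (G.isOpen_compl_drawing.connectedComponentIn.mem_nhds (mem_connectedComponentIn hx.1))
    fun y hy => mem_outerRegion_of_component_eq hx hy

lemma mem_frontier_outerRegion_iff {x : ℝ × ℝ} (hx : x ∈ G.drawing) :
    x ∈ frontier G.outerRegion ↔ x ∈ closure G.outerRegion := by
  rw [G.isOpen_outerRegion.frontier_eq]
  exact ⟨fun h => h.1, fun h => ⟨h, fun h' => h'.1 hx⟩⟩

lemma subset_outerRegion_of_isPreconnected {S : Set (ℝ × ℝ)} {x : ℝ × ℝ}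
    (hS : IsPreconnected S) (hSd : Disjoint S G.drawing) (hxS : x ∈ S)
    (hx : x ∈ G.outerRegion) : S ⊆ G.outerRegion := fun _ hy =>
  mem_outerRegion_of_component_eq hx
    (hS.subset_connectedComponentIn hxS (Set.disjoint_left.1 hSd) hy)

lemma IsFace.notMem_outerRegion {F : Set (ℝ × ℝ)} {x : ℝ × ℝ} (hF : G.IsFace F)
    (hb : Bornology.IsBounded F) (hx : x ∈ F) : x ∉ G.outerRegion := by
  intro h
  apply h.2
  rwa [← hF.eq_component hx]

/-- The union of all edges other than `ab`, together with the points `a` and `b`. -/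
def otherEdges (G : PlaneGraph) (a b : ℝ × ℝ) : Set (ℝ × ℝ) :=
  (G.deleteEdge a b).drawing ∪ {a, b}

/-- The vector `b - a` turned counterclockwise by a right angle. -/
def leftNormal (a b : ℝ × ℝ) : ℝ × ℝ := (-(b.2 - a.2), b.1 - a.1)

/-- A thin region along the left side of the edge from `a` to `b`. -/
def leftStrip (G : PlaneGraph) (a b : ℝ × ℝ) : Set (ℝ × ℝ) :=
  {x | ∃ t s : ℝ, 0 < t ∧ t < 1 ∧ 0 < s ∧
    s * ‖leftNormal a b‖ < Metric.infDist (a + t • (b - a)) (G.otherEdges a b) ∧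
    x = a + t • (b - a) + s • leftNormal a b}

lemma isClosed_otherEdges (G : PlaneGraph) (a b : ℝ × ℝ) : IsClosed (G.otherEdges a b) :=
  (isCompact_drawing _).isClosed.union (Set.toFinite _).isClosed

lemma otherEdges_nonempty (G : PlaneGraph) (a b : ℝ × ℝ) : (G.otherEdges a b).Nonempty :=
  ⟨a, by simp [otherEdges]⟩

lemma otherEdges_comm (G : PlaneGraph) (a b : ℝ × ℝ) : G.otherEdges b a = G.otherEdges a b := by
  unfold otherEdges drawing deleteEdge
  rw [Set.pair_comm]
  congr 1
  ext x
  simp only [Set.mem_ofPred_eq, or_comm]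

lemma leftNormal_swap (a b : ℝ × ℝ) : leftNormal b a = -leftNormal a b := by
  ext <;> simp [leftNormal]

lemma leftNormal_ne_zero {a b : ℝ × ℝ} (h : a ≠ b) : leftNormal a b ≠ 0 := by
  intro h0
  simp only [leftNormal, Prod.mk_eq_zero] at h0
  apply h
  ext <;> linarith [h0.1, h0.2]

lemma normSq_pos {a b : ℝ × ℝ} (h : a ≠ b) : 0 < (b.1 - a.1) ^ 2 + (b.2 - a.2) ^ 2 := by
  by_contra! hle
  apply h
  ext
  · nlinarith [sq_nonneg (b.1 - a.1), sq_nonneg (b.2 - a.2)]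
  · nlinarith [sq_nonneg (b.1 - a.1), sq_nonneg (b.2 - a.2)]

lemma Adj.ne {p q : ℝ × ℝ} (h : G.Adj p q) : p ≠ q := by
  rintro rfl
  exact G.loopless p h

lemma cross_strip (a b : ℝ × ℝ) (t s : ℝ) :
    cross a b (a + t • (b - a) + s • leftNormal a b) =
      s * ((b.1 - a.1) ^ 2 + (b.2 - a.2) ^ 2) := by
  simp [cross, leftNormal]; ring

lemma cross_pos_of_mem_leftStrip {a b x : ℝ × ℝ} (h : a ≠ b) (hx : x ∈ G.leftStrip a b) :
    0 < cross a b x := by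
  obtain ⟨t, s, -, -, hs, -, rfl⟩ := hx
  rw [cross_strip]
  exact mul_pos hs (normSq_pos h)

lemma edge_point_mem_segment {a b : ℝ × ℝ} {t : ℝ} (h0 : 0 ≤ t) (h1 : t ≤ 1) :
    a + t • (b - a) ∈ segment ℝ a b := by
  rw [segment_eq_image']
  exact ⟨t, ⟨h0, h1⟩, rfl⟩

lemma edge_point_ne {a b : ℝ × ℝ} {t : ℝ} (h : a ≠ b) (h0 : 0 < t) (h1 : t < 1) :
    a + t • (b - a) ∉ ({a, b} : Set (ℝ × ℝ)) := by
  have hba : b - a ≠ 0 := sub_ne_zero.2 h.symm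
  rintro (e | e)
  · rw [add_eq_left, smul_eq_zero] at e
    rcases e with e | e
    · linarith
    · exact hba e
  · have : (t - 1) • (b - a) = 0 := by
      rw [sub_smul, one_smul, ← sub_eq_zero.2 e]; abel
    rw [smul_eq_zero] at this
    rcases this with e | e
    · linarith
    · exact hba e

lemma IsEmbedded.edge_eq (hE : G.IsEmbedded) {a b p q : ℝ × ℝ} {t : ℝ} (hab : G.Adj a b)
    (hpq : G.Adj p q) (h0 : 0 < t) (h1 : t < 1) (hx : a + t • (b - a) ∈ segment ℝ p q) :
    (a = p ∧ b = q) ∨ (a = q ∧ b = p) := by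
  rcases hE.1 a b p q hab hpq _ (edge_point_mem_segment h0.le h1.le) hx with h | h
  · exact Set.pair_eq_pair_iff.1 h
  · exact absurd h.1 (edge_point_ne (Adj.ne hab) h0 h1)

lemma IsEmbedded.notMem_otherEdges (hE : G.IsEmbedded) {a b : ℝ × ℝ} {t : ℝ} (hab : G.Adj a b)
    (h0 : 0 < t) (h1 : t < 1) : a + t • (b - a) ∉ G.otherEdges a b := by
  rintro (⟨p, q, ⟨hpq, hne⟩, hx⟩ | hx)
  · apply hne
    rcases hE.edge_eq hab hpq h0 h1 hx with ⟨rfl, rfl⟩ | ⟨rfl, rfl⟩ <;> simp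
  · exact edge_point_ne (Adj.ne hab) h0 h1 hx

lemma IsEmbedded.infDist_pos (hE : G.IsEmbedded) {a b : ℝ × ℝ} {t : ℝ} (hab : G.Adj a b)
    (h0 : 0 < t) (h1 : t < 1) : 0 < Metric.infDist (a + t • (b - a)) (G.otherEdges a b) :=
  ((G.isClosed_otherEdges a b).notMem_iff_infDist_pos (G.otherEdges_nonempty a b)).1
    (hE.notMem_otherEdges hab h0 h1)

lemma leftStrip_disjoint_drawing {a b : ℝ × ℝ} (h : a ≠ b) :
    Disjoint (G.leftStrip a b) G.drawing := by
  rw [Set.disjoint_left]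
  intro x hx
  have hc := cross_pos_of_mem_leftStrip h hx
  obtain ⟨t, s, -, -, hs, hd, rfl⟩ := hx
  rintro ⟨p, q, hpq, hmem⟩
  by_cases he : (p = a ∧ q = b) ∨ (p = b ∧ q = a)
  · have : a + t • (b - a) + s • leftNormal a b ∈ segment ℝ a b := by
      rcases he with ⟨rfl, rfl⟩ | ⟨rfl, rfl⟩
      · exact hmem
      · rwa [segment_symm]
    rw [cross_eq_zero_of_mem_segment this] at hc
    exact lt_irrefl _ hc
  · have hb : a + t • (b - a) + s • leftNormal a b ∈ G.otherEdges a b :=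
      Or.inl ⟨p, q, ⟨hpq, he⟩, hmem⟩
    have := Metric.infDist_le_dist_of_mem (x := a + t • (b - a)) hb
    rw [dist_self_add_right, norm_smul, Real.norm_of_nonneg hs.le] at this
    linarith

lemma IsEmbedded.isPreconnected_leftStrip (hE : G.IsEmbedded) {a b : ℝ × ℝ} (hab : G.Adj a b) :
    IsPreconnected (G.leftStrip a b) := by
  have hn : 0 < ‖leftNormal a b‖ := norm_pos_iff.2 (leftNormal_ne_zero (Adj.ne hab))
  have himg : G.leftStrip a b = (fun z : ℝ × ℝ => a + z.1 • (b - a) +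
      (z.2 * Metric.infDist (a + z.1 • (b - a)) (G.otherEdges a b) / ‖leftNormal a b‖) •
        leftNormal a b) '' (Set.Ioo 0 1 ×ˢ Set.Ioo 0 1) := by
    ext x
    constructor
    · rintro ⟨t, s, h0, h1, hs, hd, rfl⟩
      have hp := hE.infDist_pos hab h0 h1
      refine ⟨(t, s * ‖leftNormal a b‖ /
        Metric.infDist (a + t • (b - a)) (G.otherEdges a b)), ⟨⟨h0, h1⟩, by positivity, ?_⟩, ?_⟩
      · exact (div_lt_one hp).2 hd
      · dsimp only
        congr 2
        field_simp
    · rintro ⟨⟨t, r⟩, ⟨⟨h0, h1⟩, hr0, hr1⟩, rfl⟩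
      have hp := hE.infDist_pos hab h0 h1
      dsimp only at h0 h1 hr0 hr1
      refine ⟨t, _, h0, h1, ?_, ?_, rfl⟩
      · positivity
      · dsimp only
        rw [div_mul_cancel₀ _ hn.ne']
        nlinarith
  rw [himg]
  refine (isPreconnected_Ioo.prod isPreconnected_Ioo).image _ (Continuous.continuousOn ?_)
  have := Metric.continuous_infDist_pt (G.otherEdges a b)
  fun_prop

lemma IsEmbedded.edge_nhds (hE : G.IsEmbedded) {a b : ℝ × ℝ} (hab : G.Adj a b) {t : ℝ}
    (h0 : 0 < t) (h1 : t < 1) :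
    G.leftStrip a b ∪ G.leftStrip b a ∪ segment ℝ a b ∈ nhds (a + t • (b - a)) := by
  have hN := normSq_pos (Adj.ne hab)
  set N := (b.1 - a.1) ^ 2 + (b.2 - a.2) ^ 2 with hNdef
  let τ : ℝ × ℝ → ℝ := fun z =>
    ((z.1 - a.1) * (b.1 - a.1) + (z.2 - a.2) * (b.2 - a.2)) / N
  let σ : ℝ × ℝ → ℝ := fun z => cross a b z / N
  have hτ : Continuous τ := by fun_prop
  have hσ : Continuous σ := (continuous_cross a b).div_const N
  have hz : ∀ z, z = a + τ z • (b - a) + σ z • leftNormal a b := by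
    intro z
    ext
    · simp [τ, σ, leftNormal, cross]; field_simp; rw [hNdef]; ring
    · simp [τ, σ, leftNormal, cross]; field_simp; rw [hNdef]; ring
  have hτy : τ (a + t • (b - a)) = t := by
    simp [τ]; field_simp; rw [hNdef]
  have hσy : σ (a + t • (b - a)) = 0 := by
    simp [σ, cross]; left; ring
  have hd : Continuous fun z => Metric.infDist (a + τ z • (b - a)) (G.otherEdges a b) :=
    (Metric.continuous_infDist_pt _).comp (by fun_prop)
  have hp := hE.infDist_pos hab h0 h1
  have e1 : ∀ᶠ z in nhds (a + t • (b - a)), 0 < τ z :=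
    hτ.continuousAt.eventually_const_lt (by rwa [hτy])
  have e2 : ∀ᶠ z in nhds (a + t • (b - a)), τ z < 1 :=
    hτ.continuousAt.eventually_lt_const (by rwa [hτy])
  have e3 : ∀ᶠ z in nhds (a + t • (b - a)), |σ z| * ‖leftNormal a b‖ <
      Metric.infDist (a + τ z • (b - a)) (G.otherEdges a b) := by
    refine ContinuousAt.eventually_lt (Continuous.continuousAt (by fun_prop)) hd.continuousAt ?_
    rw [hσy, hτy]
    simpa using hp
  filter_upwards [e1, e2, e3] with z h1 h2 h3
  rcases lt_trichotomy (σ z) 0 with hs | hs | hs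
  · refine Or.inl (Or.inr ⟨1 - τ z, -σ z, by linarith, by linarith, by linarith, ?_, ?_⟩)
    · rw [abs_of_neg hs] at h3
      have : b + (1 - τ z) • (a - b) = a + τ z • (b - a) := by
        ext <;> simp <;> ring
      rw [leftNormal_swap, norm_neg, otherEdges_comm, this]
      exact h3
    · rw [leftNormal_swap]
      conv_lhs => rw [hz z]
      ext <;> simp <;> ring
  · right
    rw [hz z, hs, zero_smul, add_zero]
    exact edge_point_mem_segment h1.le h2.le
  · rw [abs_of_pos hs] at h3
    exact Or.inl (Or.inl ⟨τ z, σ z, h1, h2, hs, h3, hz z⟩)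

lemma IsEmbedded.tendsto_leftStrip (hE : G.IsEmbedded) {a b : ℝ × ℝ} (hab : G.Adj a b) {t : ℝ}
    (h0 : 0 < t) (h1 : t < 1) : a + t • (b - a) ∈ closure (G.leftStrip a b) := by
  have hp := hE.infDist_pos hab h0 h1
  have hc : Continuous fun s : ℝ => a + t • (b - a) + s • leftNormal a b := by fun_prop
  have ht : Filter.Tendsto (fun s : ℝ => a + t • (b - a) + s • leftNormal a b)
      (nhdsWithin 0 (Set.Ioi 0)) (nhds (a + t • (b - a))) := by
    have := (hc.tendsto 0).mono_left (nhdsWithin_le_nhds (s := Set.Ioi 0))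
    simpa using this
  refine mem_closure_of_tendsto ht ?_
  have e : ∀ᶠ s in nhds (0 : ℝ), s * ‖leftNormal a b‖ <
      Metric.infDist (a + t • (b - a)) (G.otherEdges a b) :=
    (Continuous.continuousAt (by fun_prop)).eventually_lt_const (by simpa using hp)
  filter_upwards [nhdsWithin_le_nhds e, self_mem_nhdsWithin] with s hs hs0
  exact ⟨t, s, h0, h1, hs0, hs, rfl⟩

lemma IsEmbedded.leftStrip_nonempty (hE : G.IsEmbedded) {a b : ℝ × ℝ} (hab : G.Adj a b) :
    (G.leftStrip a b).Nonempty := by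
  have := hE.tendsto_leftStrip hab (t := 1 / 2) (by norm_num) (by norm_num)
  exact closure_nonempty_iff.1 ⟨_, this⟩

lemma IsEmbedded.segment_subset_closure_leftStrip (hE : G.IsEmbedded) {a b : ℝ × ℝ}
    (hab : G.Adj a b) : segment ℝ a b ⊆ closure (G.leftStrip a b) := by
  rw [← closure_openSegment]
  refine closure_minimal ?_ isClosed_closure
  rw [openSegment_eq_image']
  rintro _ ⟨t, ⟨h0, h1⟩, rfl⟩
  exact hE.tendsto_leftStrip hab h0 h1

lemma IsEmbedded.leftStrip_subset_face (hE : G.IsEmbedded) {a b x : ℝ × ℝ} {F : Set (ℝ × ℝ)}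
    (hab : G.Adj a b) (hF : G.IsFace F) (hx : x ∈ G.leftStrip a b) (hxF : x ∈ F) :
    G.leftStrip a b ⊆ F :=
  hF.subset_of_isPreconnected (hE.isPreconnected_leftStrip hab)
    (leftStrip_disjoint_drawing (Adj.ne hab)) hx hxF

lemma IsEmbedded.leftStrip_subset_outerRegion (hE : G.IsEmbedded) {a b : ℝ × ℝ} {t : ℝ}
    (hab : G.Adj a b) (h0 : 0 < t) (h1 : t < 1) (h : a + t • (b - a) ∈ closure G.outerRegion) :
    G.leftStrip a b ⊆ G.outerRegion ∨ G.leftStrip b a ⊆ G.outerRegion := by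
  obtain ⟨x, hx, hxO⟩ := mem_closure_iff_nhds.1 h _ (hE.edge_nhds hab h0 h1)
  have hba := G.symm _ _ hab
  rcases hx with (hx | hx) | hx
  · exact Or.inl (subset_outerRegion_of_isPreconnected (hE.isPreconnected_leftStrip hab)
      (leftStrip_disjoint_drawing (Adj.ne hab)) hx hxO)
  · exact Or.inr (subset_outerRegion_of_isPreconnected (hE.isPreconnected_leftStrip hba)
      (leftStrip_disjoint_drawing (Adj.ne hba)) hx hxO)
  · exact absurd (segment_subset_drawing hab hx) hxO.1

/-- The triangle `abc` is a counterclockwise triangular face. -/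
def IsTriFace (G : PlaneGraph) (a b c : ℝ × ℝ) : Prop :=
  G.Adj a b ∧ G.Adj b c ∧ G.Adj c a ∧ 0 < cross a b c ∧ G.IsFace (openTriangle a b c)

lemma IsTriFace.rotate {a b c : ℝ × ℝ} (h : G.IsTriFace a b c) : G.IsTriFace b c a := by
  obtain ⟨h1, h2, h3, h4, h5⟩ := h
  exact ⟨h2, h3, h1, by rwa [cross_rotate], by rwa [openTriangle_rotate]⟩

lemma IsEmbedded.leftStrip_subset_triFace (hE : G.IsEmbedded) {a b c : ℝ × ℝ}
    (h : G.IsTriFace a b c) : G.leftStrip a b ⊆ openTriangle a b c := by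
  obtain ⟨hab, -, -, hpos, hF⟩ := h
  have hb : 0 < cross b c a := by rwa [cross_rotate]
  have hc : 0 < cross c a b := by rwa [cross_rotate, cross_rotate]
  have hm := hE.tendsto_leftStrip hab (t := 1 / 2) (by norm_num) (by norm_num)
  have e1 : 0 < cross b c (a + (1 / 2 : ℝ) • (b - a)) := by
    have : cross b c (a + (1 / 2 : ℝ) • (b - a)) = cross b c a / 2 := by
      simp [cross]; ring
    rw [this]; positivity
  have e2 : 0 < cross c a (a + (1 / 2 : ℝ) • (b - a)) := by
    have : cross c a (a + (1 / 2 : ℝ) • (b - a)) = cross c a b / 2 := by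
      simp [cross]; ring
    rw [this]; positivity
  obtain ⟨x, ⟨hx1, hx2⟩, hx⟩ := mem_closure_iff_nhds.1 hm _
    (Filter.inter_mem ((continuous_cross b c).continuousAt.eventually_const_lt e1)
      ((continuous_cross c a).continuousAt.eventually_const_lt e2))
  exact hE.leftStrip_subset_face hab hF hx
    ((mem_openTriangle_iff hpos x).2 ⟨cross_pos_of_mem_leftStrip (Adj.ne hab) hx, hx1, hx2⟩)

lemma IsTriFace.notMem_outerRegion {a b c x : ℝ × ℝ} (h : G.IsTriFace a b c)
    (hx : x ∈ openTriangle a b c) : x ∉ G.outerRegion :=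
  h.2.2.2.2.notMem_outerRegion (isBounded_openTriangle a b c) hx

lemma IsNearTriangulation.exists_triFace (hG : G.IsNearTriangulation) {a b : ℝ × ℝ}
    (hab : G.Adj a b) : G.leftStrip a b ⊆ G.outerRegion ∨ ∃ c, G.IsTriFace a b c := by
  have hE := hG.1
  obtain ⟨x, hx⟩ := hE.leftStrip_nonempty hab
  have hxd := Set.disjoint_left.1 (leftStrip_disjoint_drawing (Adj.ne hab)) hx
  by_cases hb : Bornology.IsBounded (connectedComponentIn G.drawingᶜ x)
  swap
  · exact Or.inl (subset_outerRegion_of_isPreconnected (hE.isPreconnected_leftStrip hab)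
      (leftStrip_disjoint_drawing (Adj.ne hab)) hx ⟨hxd, hb⟩)
  right
  have hF := isFace_component hxd
  have hxF := mem_connectedComponentIn (F := G.drawingᶜ) hxd
  obtain ⟨p, hp, q, hq, r, hr, hpq, hqr, hpr, hFe⟩ := hG.2.2 _ hF hb
  rw [hFe] at hF hxF
  have hcpos : ∀ c, openTriangle p q r = openTriangle a b c → 0 < cross a b c := by
    intro c hc
    rw [hc] at hxF
    by_contra! hle
    have hlt := lt_of_le_of_ne hle (cross_ne_zero_of_mem_openTriangle hxF)
    have hpos : 0 < cross b a c := by rw [cross_swap]; linarith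
    rw [← openTriangle_swap, mem_openTriangle_iff hpos] at hxF
    have h1 := hxF.1
    rw [cross_swap] at h1
    have := cross_pos_of_mem_leftStrip (Adj.ne hab) hx
    linarith
  have hsub := hE.leftStrip_subset_face hab hF hx hxF
  have hm := closure_mono hsub
    (hE.tendsto_leftStrip hab (t := 1 / 2) (by norm_num) (by norm_num))
  have hm' : a + (1 / 2 : ℝ) • (b - a) ∉ openTriangle p q r := fun h =>
    hF.notMem_drawing h
      (segment_subset_drawing hab (edge_point_mem_segment (by norm_num) (by norm_num)))
  have s1 := openTriangle_swap p q r
  have r1 := openTriangle_rotate p q r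
  have hqp := G.symm _ _ hpq
  have hrq := G.symm _ _ hqr
  have hrp := G.symm _ _ hpr
  have finish : ∀ c, openTriangle p q r = openTriangle a b c → G.Adj b c → G.Adj c a →
      ∃ c, G.IsTriFace a b c := fun c hc h1 h2 => ⟨c, hab, h1, h2, hcpos c hc, hc ▸ hF⟩
  rcases openTriangle_boundary ⟨x, hxF⟩ hm hm' with h | h | h
  · rcases hE.edge_eq hab hpq (by norm_num) (by norm_num) h with ⟨rfl, rfl⟩ | ⟨rfl, rfl⟩
    · exact finish r rfl hqr hrp
    · exact finish r s1.symm hpr hrq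
  · rcases hE.edge_eq hab hqr (by norm_num) (by norm_num) h with ⟨rfl, rfl⟩ | ⟨rfl, rfl⟩
    · exact finish p r1.symm hrp hpq
    · exact finish p (r1.symm.trans (openTriangle_swap _ _ _).symm) hqp hpr
  · rcases hE.edge_eq hab hpr (by norm_num) (by norm_num) h with ⟨rfl, rfl⟩ | ⟨rfl, rfl⟩
    · exact finish q (s1.symm.trans (openTriangle_rotate _ _ _).symm) hrq hqp
    · exact finish q ((openTriangle_rotate _ _ _).symm.trans (openTriangle_rotate _ _ _).symm)
        hpq hqr

lemma eq_corner_of_mem_closure (hE : G.IsEmbedded) {a b c x : ℝ × ℝ} (hab : G.Adj a b)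
    (hbc : G.Adj b c) (hac : G.Adj a c) (hF : (openTriangle a b c).Nonempty) (hx : x ∈ G.verts)
    (hxc : x ∈ closure (openTriangle a b c)) (hxo : x ∉ openTriangle a b c) :
    x = a ∨ x = b ∨ x = c := by
  rcases openTriangle_boundary hF hxc hxo with h | h | h
  · have := hE.2 _ _ _ hab hx h; tauto
  · have := hE.2 _ _ _ hbc hx h; tauto
  · have := hE.2 _ _ _ hac hx h; tauto

lemma IsEmbedded.triFace_unique (hE : G.IsEmbedded) {a b c c' : ℝ × ℝ} (h : G.IsTriFace a b c)
    (h' : G.IsTriFace a b c') : c = c' := by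
  obtain ⟨x, hx⟩ := hE.leftStrip_nonempty h.1
  have hx1 := hE.leftStrip_subset_triFace h hx
  have hx2 := hE.leftStrip_subset_triFace h' hx
  have heq : openTriangle a b c = openTriangle a b c' := by
    rw [h.2.2.2.2.eq_component hx1, h'.2.2.2.2.eq_component hx2]
  have hcl : c ∈ closure (openTriangle a b c') := by
    rw [← heq]
    exact subset_closure_openTriangle ⟨x, hx1⟩ (subset_convexHull ℝ _ (by simp))
  have hno : c ∉ openTriangle a b c' := fun hc =>
    h'.2.2.2.2.notMem_drawing hc (left_mem_drawing h.2.2.1)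
  rcases eq_corner_of_mem_closure hE h'.1 h'.2.1 (G.symm _ _ h'.2.2.1) ⟨x, hx2⟩
    (G.mem_of_adj _ _ h.2.2.1).1 hcl hno with e | e | e
  · exact absurd h.2.2.1 (e ▸ G.loopless _)
  · exact absurd h.2.1 (e ▸ G.loopless _)
  · exact e

/-- The identification of the plane with `ℂ`. -/
def toC (x : ℝ × ℝ) : ℂ := ⟨x.1, x.2⟩

lemma continuous_toC : Continuous toC :=
  Complex.equivRealProdCLM.symm.continuous

lemma toC_injective : Function.Injective toC := by
  intro x y h
  exact Prod.ext (congrArg Complex.re h) (congrArg Complex.im h)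

lemma toC_sub_ne_zero {x y : ℝ × ℝ} (h : x ≠ y) : toC x - toC y ≠ 0 :=
  sub_ne_zero.2 (toC_injective.ne h)

/-- The quotient whose argument is the angle subtended at `x` by the segment from `p` to `q`. -/
def ratio (p q x : ℝ × ℝ) : ℂ := (toC q - toC x) / (toC p - toC x)

lemma ratio_ne_zero {p q x : ℝ × ℝ} (hp : x ≠ p) (hq : x ≠ q) : ratio p q x ≠ 0 :=
  div_ne_zero (toC_sub_ne_zero hq.symm) (toC_sub_ne_zero hp.symm)

lemma ratio_mul_ratio {p q r x : ℝ × ℝ} (hq : x ≠ q) :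
    ratio p q x * ratio q r x = ratio p r x := by
  unfold ratio
  rw [mul_comm, div_mul_div_cancel₀ (toC_sub_ne_zero hq.symm)]

lemma continuousAt_ratio {p q x : ℝ × ℝ} (hp : x ≠ p) : ContinuousAt (ratio p q) x := by
  unfold ratio
  have := continuous_toC
  exact ContinuousAt.div (by fun_prop) (by fun_prop) (toC_sub_ne_zero hp.symm)

lemma ratio_im (p q x : ℝ × ℝ) :
    (ratio p q x).im = cross p q x / Complex.normSq (toC p - toC x) := by
  unfold ratio
  rw [Complex.div_im, ← sub_div]
  congr 1
  simp [toC, cross]; ring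

lemma ratio_mem_slitPlane {p q x : ℝ × ℝ} (hx : x ∉ segment ℝ p q) :
    ratio p q x ∈ Complex.slitPlane := by
  have hp : x ≠ p := by rintro rfl; exact hx (left_mem_segment ℝ _ _)
  rw [Complex.mem_slitPlane_iff]
  by_contra! h
  obtain ⟨hre, him⟩ := h
  apply hx
  set r := -(ratio p q x).re with hr
  have hr0 : 0 ≤ r := by linarith
  have e : ratio p q x = ((-r : ℝ) : ℂ) := by
    apply Complex.ext
    · simp [hr]
    · simp [him]
  unfold ratio at e
  rw [div_eq_iff (toC_sub_ne_zero hp.symm)] at e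
  have e1 := congrArg Complex.re e
  have e2 := congrArg Complex.im e
  simp [toC] at e1 e2
  refine ⟨r / (1 + r), 1 / (1 + r), by positivity, by positivity, by field_simp; ring, ?_⟩
  ext
  · simp; field_simp; linarith
  · simp; field_simp; linarith

lemma tendsto_ratio (p q : ℝ × ℝ) :
    Filter.Tendsto (ratio p q) (Bornology.cobounded (ℝ × ℝ)) (nhds 1) := by
  have h1 : Filter.Tendsto (fun x => toC p - toC x) (Bornology.cobounded (ℝ × ℝ))
      (Bornology.cobounded ℂ) := by
    have h2 : Filter.Tendsto toC (Bornology.cobounded (ℝ × ℝ)) (Bornology.cobounded ℂ) := by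
      rw [Metric.cobounded_eq_cocompact, Metric.cobounded_eq_cocompact]
      exact Complex.equivRealProdCLM.symm.toHomeomorph.isClosedEmbedding.tendsto_cocompact
    exact (tendsto_const_sub_cobounded _).comp h2
  have h3 := (Filter.tendsto_inv₀_cobounded.comp h1).const_mul (toC q - toC p)
  have h4 := h3.const_add 1
  simp only [mul_zero, add_zero] at h4
  refine h4.congr' ?_
  have hev : ∀ᶠ x in Bornology.cobounded (ℝ × ℝ), x ≠ p := by
    exact Bornology.isBounded_def.1 (Bornology.isBounded_singleton (x := p))
  filter_upwards [hev] with x hx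
  have := toC_sub_ne_zero hx.symm
  simp only [Function.comp, ratio]
  field_simp
  ring

lemma tendsto_log_ratio (p q : ℝ × ℝ) :
    Filter.Tendsto (fun x => Complex.log (ratio p q x)) (Bornology.cobounded (ℝ × ℝ))
      (nhds 0) := by
  have := (continuousAt_clog Complex.one_mem_slitPlane).tendsto.comp (tendsto_ratio p q)
  simpa [Function.comp_def] using this

lemma continuousAt_log_ratio {p q x : ℝ × ℝ} (hx : x ∉ segment ℝ p q) :
    ContinuousAt (fun y => Complex.log (ratio p q y)) x := by
  have hp : x ≠ p := by rintro rfl; exact hx (left_mem_segment ℝ _ _)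
  exact (continuousAt_ratio hp).clog (ratio_mem_slitPlane hx)

lemma Reachable.exists_log {a b : ℝ × ℝ} (h : G.Reachable a b) :
    ∃ L : ℝ × ℝ → ℂ, (∀ x, x ∉ G.drawing → x ≠ a →
        ContinuousAt L x ∧ Complex.exp (L x) = ratio a b x) ∧
      Filter.Tendsto L (Bornology.cobounded (ℝ × ℝ)) (nhds 0) := by
  induction h with
  | refl =>
    refine ⟨fun _ => 0, fun x _ hx => ⟨continuousAt_const, ?_⟩, tendsto_const_nhds⟩
    rw [Complex.exp_zero, ratio, div_self (toC_sub_ne_zero hx.symm)]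
  | @tail b c _ hbc ih =>
    obtain ⟨L, hL, hL0⟩ := ih
    refine ⟨fun x => L x + Complex.log (ratio b c x), fun x hx hxa => ?_, ?_⟩
    · have hs : x ∉ segment ℝ b c := fun h => hx (segment_subset_drawing hbc h)
      have hb : x ≠ b := by rintro rfl; exact hs (left_mem_segment ℝ _ _)
      have hc : x ≠ c := by rintro rfl; exact hs (right_mem_segment ℝ _ _)
      refine ⟨(hL x hx hxa).1.add (continuousAt_log_ratio hs), ?_⟩
      rw [Complex.exp_add, (hL x hx hxa).2, Complex.exp_log (ratio_ne_zero hb hc),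
        ratio_mul_ratio hb]
    · simpa using hL0.add (tendsto_log_ratio b c)

lemma constant_of_exp_eq_one {Θ : ℝ × ℝ → ℂ} {S : Set (ℝ × ℝ)} (hS : IsPreconnected S)
    (hc : ContinuousOn Θ S) (he : ∀ x ∈ S, Complex.exp (Θ x) = 1) {x y : ℝ × ℝ} (hx : x ∈ S)
    (hy : y ∈ S) : Θ x = Θ y := by
  have h2 : (2 * Real.pi : ℝ) ≠ 0 := by positivity
  have hmem : ∀ z ∈ S, ∃ n : ℤ, Θ z = n * (2 * Real.pi * Complex.I) := fun z hz =>
    Complex.exp_eq_one_iff.1 (he z hz)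
  have him : ∀ z ∈ S, ∃ n : ℤ, (Θ z).im / (2 * Real.pi) = n := by
    intro z hz
    obtain ⟨n, hn⟩ := hmem z hz
    refine ⟨n, ?_⟩
    rw [hn]
    simp
  have hg : ContinuousOn (fun z => round ((Θ z).im / (2 * Real.pi))) S := by
    intro z hz
    have hcont : ContinuousWithinAt (fun z => (Θ z).im / (2 * Real.pi)) S z :=
      (Complex.continuous_im.continuousAt.comp_continuousWithinAt (hc z hz)).div_const _
    rw [ContinuousWithinAt, nhds_discrete]
    obtain ⟨n, hn⟩ := him z hz
    have hb := hcont (Metric.ball_mem_nhds _ (by norm_num : (0 : ℝ) < 1 / 2))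
    rw [Filter.tendsto_pure]
    filter_upwards [hb, self_mem_nhdsWithin] with w hw hwS
    obtain ⟨m, hm⟩ := him w hwS
    simp only [Set.mem_preimage, Metric.mem_ball] at hw
    rw [hm, hn] at hw ⊢
    rw [Int.dist_cast_real, Int.dist_eq] at hw
    have : |m - n| < 1 := by
      have : |(m : ℝ) - n| < 1 := by linarith
      exact_mod_cast this
    have : m = n := by
      rw [Int.abs_lt_one_iff] at this; omega
    rw [this]
  have hr := hS.constant hg hx hy
  obtain ⟨n, hn⟩ := hmem x hx
  obtain ⟨m, hm⟩ := hmem y hy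
  have e : ∀ k : ℤ, (((k : ℂ) * (2 * Real.pi * Complex.I)).im / (2 * Real.pi)) = k := by
    intro k
    simp
  simp only [hn, hm, e, round_intCast] at hr
  rw [hn, hm, hr]

lemma eq_of_tendsto_of_eqOn {Θ : ℝ × ℝ → ℂ} {S : Set (ℝ × ℝ)} {y : ℝ × ℝ} {c k : ℂ}
    (hy : y ∈ closure S) (ht : Filter.Tendsto Θ (nhdsWithin y S) (nhds c))
    (hk : ∀ x ∈ S, Θ x = k) : k = c := by
  have := mem_closure_iff_nhdsWithin_neBot.1 hy
  refine tendsto_nhds_unique (tendsto_const_nhds.congr' ?_) ht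
  filter_upwards [self_mem_nhdsWithin] with x hx
  exact (hk x hx).symm

lemma midpoint_comm' (a b : ℝ × ℝ) : b + (1 / 2 : ℝ) • (a - b) = a + (1 / 2 : ℝ) • (b - a) := by
  ext <;> simp <;> ring

lemma ratio_midpoint {a b : ℝ × ℝ} (h : a ≠ b) :
    ratio a b (a + (1 / 2 : ℝ) • (b - a)) = -1 := by
  have hm : toC (a + (1 / 2 : ℝ) • (b - a)) = (toC a + toC b) / 2 := by
    apply Complex.ext <;> simp [toC] <;> ring
  unfold ratio
  rw [hm, div_eq_iff]
  · ring
  · have := toC_sub_ne_zero h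
    intro h0
    apply this
    linear_combination 2 * h0

lemma normSq_toC_pos {p x : ℝ × ℝ} (h : x ≠ p) : 0 < Complex.normSq (toC p - toC x) :=
  Complex.normSq_pos.2 (toC_sub_ne_zero h.symm)

lemma tendsto_log_left {a b : ℝ × ℝ} (h : a ≠ b) {S : Set (ℝ × ℝ)}
    (hS : ∀ x ∈ S, 0 < cross a b x) :
    Filter.Tendsto (fun x => Complex.log (ratio a b x))
      (nhdsWithin (a + (1 / 2 : ℝ) • (b - a)) S) (nhds (Real.pi * Complex.I)) := by
  have hne : a + (1 / 2 : ℝ) • (b - a) ≠ a := fun e =>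
    edge_point_ne h (t := 1 / 2) (by norm_num) (by norm_num) (Or.inl e)
  have h1 := Complex.tendsto_log_nhdsWithin_im_nonneg_of_re_neg_of_im_zero (z := -1)
    (by simp) (by simp)
  have h2 : Filter.Tendsto (ratio a b) (nhdsWithin (a + (1 / 2 : ℝ) • (b - a)) S)
      (nhdsWithin (-1) {z : ℂ | 0 ≤ z.im}) := by
    refine tendsto_nhdsWithin_iff.2 ⟨?_, ?_⟩
    · rw [← ratio_midpoint h]
      exact (continuousAt_ratio hne).tendsto.mono_left nhdsWithin_le_nhds
    · filter_upwards [self_mem_nhdsWithin] with x hx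
      rw [ratio_im]
      exact div_nonneg (hS x hx).le (Complex.normSq_nonneg _)
  simpa [Function.comp_def] using h1.comp h2

lemma tendsto_log_right {a b : ℝ × ℝ} (h : a ≠ b) {S : Set (ℝ × ℝ)}
    (hS : ∀ x ∈ S, cross a b x < 0) :
    Filter.Tendsto (fun x => Complex.log (ratio a b x))
      (nhdsWithin (a + (1 / 2 : ℝ) • (b - a)) S) (nhds (-(Real.pi * Complex.I))) := by
  have hne : a + (1 / 2 : ℝ) • (b - a) ≠ a := fun e =>
    edge_point_ne h (t := 1 / 2) (by norm_num) (by norm_num) (Or.inl e)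
  have h1 := Complex.tendsto_log_nhdsWithin_im_neg_of_re_neg_of_im_zero (z := -1)
    (by simp) (by simp)
  have h2 : Filter.Tendsto (ratio a b) (nhdsWithin (a + (1 / 2 : ℝ) • (b - a)) S)
      (nhdsWithin (-1) {z : ℂ | z.im < 0}) := by
    refine tendsto_nhdsWithin_iff.2 ⟨?_, ?_⟩
    · rw [← ratio_midpoint h]
      exact (continuousAt_ratio hne).tendsto.mono_left nhdsWithin_le_nhds
    · filter_upwards [self_mem_nhdsWithin] with x hx
      have hxa : x ≠ a := by
        rintro rfl
        have := hS x hx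
        rw [cross_self_outer] at this
        exact lt_irrefl _ this
      rw [ratio_im]
      exact div_neg_of_neg_of_pos (hS x hx) (normSq_toC_pos hxa)
  simpa [Function.comp_def] using h1.comp h2

lemma cross_neg_of_mem_leftStrip {a b x : ℝ × ℝ} (h : a ≠ b) (hx : x ∈ G.leftStrip b a) :
    cross a b x < 0 := by
  have := cross_pos_of_mem_leftStrip h.symm hx
  rw [cross_swap] at this
  linarith

lemma IsNearTriangulation.mem_of_link_closed (hG : G.IsNearTriangulation) {w a b : ℝ × ℝ}
    {A : Set (ℝ × ℝ)} (hA : ∀ p ∈ A, G.Adj w p)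
    (hcl : ∀ p q, G.IsTriFace w p q → (p ∈ A ↔ q ∈ A)) (ha : a ∈ A) (hb : G.Adj w b) :
    b ∈ A := by
  by_contra hbA
  have hE := hG.1
  have hwa := hA a ha
  have hr : (G.deleteVerts {w}).Reachable a b := by
    refine (hG.2.1.2.2 w (G.mem_of_adj _ _ hb).1).2 a ?_ b ?_
    · exact Finset.mem_sdiff.2 ⟨(G.mem_of_adj _ _ hwa).2, by simpa using (Adj.ne hwa).symm⟩
    · exact Finset.mem_sdiff.2 ⟨(G.mem_of_adj _ _ hb).2, by simpa using (Adj.ne hb).symm⟩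
  obtain ⟨L, hL, hL0⟩ := hr.exists_log
  set Θ : ℝ × ℝ → ℂ := fun x => Complex.log (ratio w a x) + (L x + Complex.log (ratio b w x))
    with hΘ
  have hbw := G.symm _ _ hb
  have hsubd : (G.deleteVerts {w}).drawing ⊆ G.drawing :=
    fun x ⟨p, q, hpq, hx⟩ => ⟨p, q, hpq.1, hx⟩
  have hcont : ∀ x, x ∉ G.drawing → ContinuousAt Θ x := by
    intro x hx
    refine (continuousAt_log_ratio fun h => hx (segment_subset_drawing hwa h)).add
      ((hL x (fun h => hx (hsubd h)) ?_).1.add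
        (continuousAt_log_ratio fun h => hx (segment_subset_drawing hbw h)))
    rintro rfl
    exact hx (left_mem_drawing (G.symm _ _ hwa))
  have hexp : ∀ x, x ∉ G.drawing → Complex.exp (Θ x) = 1 := by
    intro x hx
    have hxw : x ≠ w := by rintro rfl; exact hx (left_mem_drawing hwa)
    have hxa : x ≠ a := by rintro rfl; exact hx (left_mem_drawing (G.symm _ _ hwa))
    have hxb : x ≠ b := by rintro rfl; exact hx (left_mem_drawing hbw)
    rw [hΘ]
    dsimp only
    rw [Complex.exp_add, Complex.exp_add, (hL x (fun h => hx (hsubd h)) hxa).2,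
      Complex.exp_log (ratio_ne_zero hxw hxa), Complex.exp_log (ratio_ne_zero hxb hxw),
      ratio_mul_ratio hxb, ratio_mul_ratio hxa, ratio, div_self (toC_sub_ne_zero hxw.symm)]
  have hconst : ∀ S : Set (ℝ × ℝ), IsPreconnected S → Disjoint S G.drawing →
      ∀ x ∈ S, ∀ y ∈ S, Θ x = Θ y := fun S hS hSd x hx y hy =>
    constant_of_exp_eq_one hS
      (fun z hz => (hcont z (Set.disjoint_left.1 hSd hz)).continuousWithinAt)
      (fun z hz => hexp z (Set.disjoint_left.1 hSd hz)) hx hy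
  have hΘ0 : Filter.Tendsto Θ (Bornology.cobounded (ℝ × ℝ)) (nhds 0) := by
    simpa using (tendsto_log_ratio w a).add (hL0.add (tendsto_log_ratio b w))
  have houter : ∀ x ∈ G.outerRegion, Θ x = 0 := by
    intro x hx
    have hF := isFace_component hx.1
    have : (Bornology.cobounded (ℝ × ℝ) ⊓
        Filter.principal (connectedComponentIn G.drawingᶜ x)).NeBot := by
      rw [Filter.neBot_iff, Ne, Filter.inf_principal_eq_bot, ← Bornology.isBounded_def]
      exact hx.2
    refine tendsto_nhds_unique (tendsto_const_nhds.congr' ?_) (hΘ0.mono_left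
      (inf_le_left (b := Filter.principal (connectedComponentIn G.drawingᶜ x))))
    filter_upwards [Filter.mem_inf_of_right (Filter.mem_principal_self _)] with y hy
    exact hconst _ hF.isPreconnected
      (Set.disjoint_left.2 fun z hz => hF.notMem_drawing hz) x
      (mem_connectedComponentIn hx.1) y hy
  have hval : ∀ p q, ∃ k, G.Adj p q → ∀ x ∈ G.leftStrip p q, Θ x = k := by
    intro p q
    by_cases hpq : G.Adj p q
    · obtain ⟨z, hz⟩ := hE.leftStrip_nonempty hpq
      exact ⟨Θ z, fun _ x hx => hconst _ (hE.isPreconnected_leftStrip hpq)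
        (leftStrip_disjoint_drawing (Adj.ne hpq)) x hx z hz⟩
    · exact ⟨0, fun h => absurd h hpq⟩
  choose J hJ using hval
  have hJtri : ∀ p q, G.IsTriFace w p q → J w p = J q w := by
    intro p q h
    obtain ⟨x, hx⟩ := hE.leftStrip_nonempty h.1
    obtain ⟨y, hy⟩ := hE.leftStrip_nonempty h.2.2.1
    rw [← hJ w p h.1 x hx, ← hJ q w h.2.2.1 y hy]
    have hx' := hE.leftStrip_subset_triFace h hx
    have hy' := hE.leftStrip_subset_triFace h.rotate.rotate hy
    rw [← openTriangle_rotate] at hy'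
    have hF := h.2.2.2.2
    exact hconst _ hF.isPreconnected (Set.disjoint_left.2 fun z hz => hF.notMem_drawing hz)
      x hx' y hy'
  have hJouter : ∀ p q, G.Adj p q → J p q ≠ 0 → ∃ c, G.IsTriFace p q c := by
    intro p q hpq hne
    refine (hG.exists_triFace hpq).resolve_left fun hsub => hne ?_
    obtain ⟨x, hx⟩ := hE.leftStrip_nonempty hpq
    rw [← hJ p q hpq x hx]
    exact houter x (hsub hx)
  have hnd : ∀ p, G.Adj w p → w + (1 / 2 : ℝ) • (p - w) ∉ (G.deleteVerts {w}).drawing := by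
    rintro p hp ⟨x, z, ⟨hxz, hx, hz⟩, hmem⟩
    rcases hE.edge_eq hp hxz (by norm_num) (by norm_num) hmem with h | h
    · exact hx (by simp [h.1])
    · exact hz (by simp [h.1])
  have hclL : ∀ p, G.Adj w p → w + (1 / 2 : ℝ) • (p - w) ∈ closure (G.leftStrip w p) :=
    fun p hp => hE.tendsto_leftStrip hp (by norm_num) (by norm_num)
  have hclR : ∀ p, G.Adj w p → w + (1 / 2 : ℝ) • (p - w) ∈ closure (G.leftStrip p w) := by
    intro p hp
    rw [← midpoint_comm']
    exact hE.tendsto_leftStrip (G.symm _ _ hp) (by norm_num) (by norm_num)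
  have hns : ∀ p q, G.Adj w p → G.Adj w q → p ≠ q →
      w + (1 / 2 : ℝ) • (p - w) ∉ segment ℝ w q := by
    intro p q hp hq hne hmem
    rcases hE.edge_eq hp hq (by norm_num) (by norm_num) hmem with h | h
    · exact hne h.2
    · exact Adj.ne hq h.1
  have hns' : ∀ p, G.Adj w p → p ≠ b → w + (1 / 2 : ℝ) • (p - w) ∉ segment ℝ b w := by
    intro p hp hne
    rw [segment_symm]
    exact hns p b hp hb hne
  have hmida : w + (1 / 2 : ℝ) • (a - w) ≠ a := fun e =>
    edge_point_ne (Adj.ne hwa) (t := 1 / 2) (by norm_num) (by norm_num) (Or.inr e)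
  have hJeq : ∀ p, p ∈ A → p ≠ a → J w p = J p w := by
    intro p hpA hpa
    have hp := hA p hpA
    have hpb : p ≠ b := by rintro rfl; exact hbA hpA
    have hsa := hns p a hp hwa hpa
    have hc : ContinuousAt Θ (w + (1 / 2 : ℝ) • (p - w)) :=
      (continuousAt_log_ratio hsa).add ((hL _ (hnd p hp)
        (fun e => hsa (e.symm ▸ right_mem_segment ℝ w a))).1.add
          (continuousAt_log_ratio (hns' p hp hpb)))
    rw [eq_of_tendsto_of_eqOn (hclL p hp) (hc.tendsto.mono_left nhdsWithin_le_nhds) (hJ w p hp),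
      eq_of_tendsto_of_eqOn (hclR p hp) (hc.tendsto.mono_left nhdsWithin_le_nhds)
        (hJ p w (G.symm _ _ hp))]
  have hab : a ≠ b := by rintro rfl; exact hbA ha
  have hJne : J w a - J a w ≠ 0 := by
    have hc : ContinuousAt (fun x => L x + Complex.log (ratio b w x))
        (w + (1 / 2 : ℝ) • (a - w)) :=
      (hL _ (hnd a hwa) hmida).1.add (continuousAt_log_ratio (hns' a hwa hab))
    have h1 := (tendsto_log_left (Adj.ne hwa) fun x hx =>
      cross_pos_of_mem_leftStrip (G := G) (Adj.ne hwa) hx).add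
        (hc.tendsto.mono_left nhdsWithin_le_nhds)
    have h2 := (tendsto_log_right (Adj.ne hwa) fun x hx =>
      cross_neg_of_mem_leftStrip (G := G) (Adj.ne hwa) hx).add
        (hc.tendsto.mono_left nhdsWithin_le_nhds)
    rw [eq_of_tendsto_of_eqOn (hclL a hwa) h1 (hJ w a hwa),
      eq_of_tendsto_of_eqOn (hclR a hwa) h2 (hJ a w (G.symm _ _ hwa)),
      add_sub_add_right_eq_sub, sub_neg_eq_add, ← two_mul]
    have := Real.pi_ne_zero
    simp [this]
  have hmem : ∀ p, p ∈ G.verts.filter (· ∈ A) ↔ p ∈ A := by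
    intro p
    rw [Finset.mem_filter]
    exact ⟨fun h => h.2, fun h => ⟨(G.mem_of_adj _ _ (hA p h)).2, h⟩⟩
  have hsum : ∑ p ∈ G.verts.filter (· ∈ A), J w p = ∑ p ∈ G.verts.filter (· ∈ A), J p w := by
    have hex : ∀ p, p ∈ G.verts.filter (· ∈ A) → J w p ≠ 0 → ∃ q, G.IsTriFace w p q :=
      fun p hp hne => hJouter w p (hA p ((hmem p).1 hp)) hne
    choose f hf using hex
    refine Finset.sum_bij_ne_zero f ?_ ?_ ?_ ?_
    · intro p hp hne
      exact (hmem _).2 ((hcl p _ (hf p hp hne)).1 ((hmem p).1 hp))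
    · intro p hp hne p' hp' hne' heq
      have h1 := (hf p hp hne).rotate.rotate
      have h2 := (hf p' hp' hne').rotate.rotate
      rw [heq] at h1
      exact hE.triFace_unique h1 h2
    · intro q hq hne
      have hqw := G.symm _ _ (hA q ((hmem q).1 hq))
      obtain ⟨p, hp⟩ := hJouter q w hqw hne
      have hp' := hp.rotate
      have hpA := (hmem p).2 ((hcl p q hp').2 ((hmem q).1 hq))
      have hne' : J w p ≠ 0 := by rwa [hJtri p q hp']
      exact ⟨p, hpA, hne', hE.triFace_unique (hf p hpA hne') hp'⟩
    · intro p hp hne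
      exact hJtri p _ (hf p hp hne)
  rw [← sub_eq_zero, ← Finset.sum_sub_distrib,
    Finset.sum_eq_single_of_mem a ((hmem a).2 ha)
      (fun p hp hpa => sub_eq_zero.2 (hJeq p ((hmem p).1 hp) hpa))] at hsum
  exact hJne hsum

lemma deleteVerts_adj {v p q : ℝ × ℝ} :
    (G.deleteVerts {v}).Adj p q ↔ G.Adj p q ∧ p ≠ v ∧ q ≠ v := by
  simp [deleteVerts]

lemma mem_deleteVerts {v x : ℝ × ℝ} : x ∈ (G.deleteVerts {v}).verts ↔ x ∈ G.verts ∧ x ≠ v := by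
  simp [deleteVerts]

lemma drawing_deleteVerts_subset (v : ℝ × ℝ) : (G.deleteVerts {v}).drawing ⊆ G.drawing :=
  fun _ ⟨p, q, hpq, hx⟩ => ⟨p, q, hpq.1, hx⟩

lemma IsEmbedded.deleteVerts (hE : G.IsEmbedded) (v : ℝ × ℝ) :
    (G.deleteVerts {v}).IsEmbedded :=
  ⟨fun p q r s h1 h2 => hE.1 p q r s h1.1 h2.1,
    fun p q x h hx => hE.2 p q x h.1 (mem_deleteVerts.1 hx).1⟩

lemma Connected.exists_adj (hG : G.Connected) (hc : 2 ≤ G.verts.card) {x : ℝ × ℝ}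
    (hx : x ∈ G.verts) : ∃ y, G.Adj x y := by
  obtain ⟨y, hy, hne⟩ := Finset.exists_mem_ne (s := G.verts) (by omega) x
  rcases Relation.ReflTransGen.cases_head (hG.2 x hx y hy) with rfl | ⟨z, hz, -⟩
  · exact absurd rfl hne
  · exact ⟨z, hz⟩

lemma card_deleteVerts {v : ℝ × ℝ} (hv : v ∈ G.verts) :
    (G.deleteVerts {v}).verts.card = G.verts.card - 1 := by
  simp [PlaneGraph.deleteVerts, Finset.card_sdiff, hv]

lemma Biconnected.exists_adj (hG : G.Biconnected) {x : ℝ × ℝ} (hx : x ∈ G.verts) :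
    ∃ y, G.Adj x y :=
  hG.2.1.exists_adj (by have := hG.1; omega) hx

lemma Biconnected.exists_adj_ne (hG : G.Biconnected) {v x : ℝ × ℝ} (hv : v ∈ G.verts)
    (hx : x ∈ G.verts) (hxv : x ≠ v) : ∃ y, (G.deleteVerts {v}).Adj x y := by
  refine (hG.2.2 v hv).exists_adj ?_ (mem_deleteVerts.2 ⟨hx, hxv⟩)
  rw [card_deleteVerts hv]
  have := hG.1
  omega

lemma Biconnected.mem_drawing (hG : G.Biconnected) {x : ℝ × ℝ} (hx : x ∈ G.verts) :
    x ∈ G.drawing :=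
  let ⟨_, hy⟩ := hG.exists_adj hx
  left_mem_drawing hy

lemma Biconnected.mem_drawing_deleteVerts (hG : G.Biconnected) {v x : ℝ × ℝ} (hv : v ∈ G.verts)
    (hx : x ∈ G.verts) (hxv : x ≠ v) : x ∈ (G.deleteVerts {v}).drawing :=
  let ⟨_, hy⟩ := hG.exists_adj_ne hv hx hxv
  left_mem_drawing hy

lemma IsEmbedded.notMem_drawing_deleteVerts (hE : G.IsEmbedded) {v : ℝ × ℝ} (hv : v ∈ G.verts) :
    v ∉ (G.deleteVerts {v}).drawing := by
  rintro ⟨p, q, h, hx⟩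
  rw [deleteVerts_adj] at h
  rcases hE.2 p q v h.1 hv hx with e | e
  · exact h.2.1 e.symm
  · exact h.2.2 e.symm

lemma IsEmbedded.spoke_notMem_drawing (hE : G.IsEmbedded) {v a : ℝ × ℝ} (hv : G.Adj v a) {t : ℝ}
    (h0 : 0 ≤ t) (h1 : t < 1) : v + t • (a - v) ∉ (G.deleteVerts {v}).drawing := by
  rcases h0.eq_or_lt with rfl | h0
  · simpa using hE.notMem_drawing_deleteVerts (G.mem_of_adj _ _ hv).1
  rintro ⟨p, q, h, hx⟩
  rw [deleteVerts_adj] at h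
  rcases hE.edge_eq hv h.1 h0 h1 hx with ⟨e, -⟩ | ⟨e, -⟩
  · exact h.2.1 e.symm
  · exact h.2.2 e.symm

lemma IsEmbedded.spoke_mem_face (hE : G.IsEmbedded) {v a : ℝ × ℝ} (hv : G.Adj v a)
    {F : Set (ℝ × ℝ)} (hF : (G.deleteVerts {v}).IsFace F) {t s : ℝ} (h0 : 0 ≤ t) (h1 : t < 1)
    (hs0 : 0 ≤ s) (hs1 : s < 1) (hx : v + t • (a - v) ∈ F) : v + s • (a - v) ∈ F := by
  have hc : IsPreconnected ((fun r : ℝ => v + r • (a - v)) '' Set.Ico 0 1) :=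
    isPreconnected_Ico.image _ (by fun_prop)
  refine hF.subset_of_isPreconnected hc ?_ ⟨t, ⟨h0, h1⟩, rfl⟩ hx ⟨s, ⟨hs0, hs1⟩, rfl⟩
  rw [Set.disjoint_left]
  rintro _ ⟨r, ⟨hr0, hr1⟩, rfl⟩
  exact hE.spoke_notMem_drawing hv hr0 hr1

lemma IsEmbedded.closure_face_of_adj (hE : G.IsEmbedded) {v a : ℝ × ℝ} (hv : G.Adj v a)
    {F : Set (ℝ × ℝ)} (hF : (G.deleteVerts {v}).IsFace F) (hvF : v ∈ F) : a ∈ closure F := by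
  have hc : Continuous fun r : ℝ => v + r • (a - v) := by fun_prop
  have h1 : (1 : ℝ) ∈ closure (Set.Ico (0 : ℝ) 1) := by
    rw [closure_Ico (by norm_num)]
    simp
  have := map_mem_closure hc h1 (t := F) fun s hs =>
    hE.spoke_mem_face hv hF le_rfl one_pos hs.1 hs.2 (by simpa using hvF)
  simpa using this

lemma IsNearTriangulation.exists_spoke (hG : G.IsNearTriangulation) {v x : ℝ × ℝ}
    (hv : v ∈ G.verts) (hx : x ∈ G.drawing) (hx' : x ∉ (G.deleteVerts {v}).drawing) :
    ∃ a, G.Adj v a ∧ ∃ t : ℝ, 0 ≤ t ∧ t < 1 ∧ x = v + t • (a - v) := by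
  have key : ∀ a, G.Adj v a → x ∈ segment ℝ v a →
      ∃ a, G.Adj v a ∧ ∃ t : ℝ, 0 ≤ t ∧ t < 1 ∧ x = v + t • (a - v) := by
    intro a ha hxa
    rw [segment_eq_image'] at hxa
    obtain ⟨t, ⟨h0, h1⟩, rfl⟩ := hxa
    rcases h1.eq_or_lt with rfl | h1
    · exfalso
      apply hx'
      simpa using hG.2.1.mem_drawing_deleteVerts hv (G.mem_of_adj _ _ ha).2 (Adj.ne ha).symm
    · exact ⟨a, ha, t, h0, h1, rfl⟩
  obtain ⟨p, q, hpq, hxs⟩ := hx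
  by_cases hp : p = v
  · subst hp
    exact key q hpq hxs
  by_cases hq : q = v
  · subst hq
    exact key p (G.symm _ _ hpq) (by rwa [segment_symm])
  · exact absurd ⟨p, q, deleteVerts_adj.2 ⟨hpq, hp, hq⟩, hxs⟩ hx'

lemma IsNearTriangulation.mem_face_of_mem_star (hG : G.IsNearTriangulation) {v x : ℝ × ℝ}
    (hv : v ∈ G.verts) {F : Set (ℝ × ℝ)} (hF : (G.deleteVerts {v}).IsFace F)
    (hx : x ∈ G.drawing) (hxF : x ∈ F) : v ∈ F := by
  obtain ⟨a, ha, t, h0, h1, rfl⟩ := hG.exists_spoke hv hx (hF.notMem_drawing hxF)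
  simpa using hG.1.spoke_mem_face ha hF h0 h1 le_rfl one_pos hxF

lemma component_subset_deleteVerts (v x : ℝ × ℝ) :
    connectedComponentIn G.drawingᶜ x ⊆ connectedComponentIn (G.deleteVerts {v}).drawingᶜ x :=
  connectedComponentIn_mono _ (Set.compl_subset_compl.2 (drawing_deleteVerts_subset v))

lemma IsNearTriangulation.isFace_of_notMem (hG : G.IsNearTriangulation) {v : ℝ × ℝ}
    (hv : v ∈ G.verts) {F : Set (ℝ × ℝ)} (hF : (G.deleteVerts {v}).IsFace F) (hvF : v ∉ F) :
    G.IsFace F := by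
  obtain ⟨y, hy⟩ := hF.nonempty
  have hd : Disjoint F G.drawing := Set.disjoint_left.2 fun x hxF hx =>
    hvF (hG.mem_face_of_mem_star hv hF hx hxF)
  have hyd := Set.disjoint_left.1 hd hy
  refine ⟨y, hyd, Set.Subset.antisymm ?_ ?_⟩
  · exact (isFace_component hyd).subset_of_isPreconnected hF.isPreconnected hd hy
      (mem_connectedComponentIn hyd)
  · rw [hF.eq_component hy]
    exact component_subset_deleteVerts v y

lemma IsFace.eq_of_mem {F F' : Set (ℝ × ℝ)} {x : ℝ × ℝ} (hF : G.IsFace F) (hF' : G.IsFace F')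
    (hx : x ∈ F) (hx' : x ∈ F') : F = F' := by
  rw [hF.eq_component hx, hF'.eq_component hx']

lemma IsNearTriangulation.exists_triangle_of_notMem (hG : G.IsNearTriangulation) {v : ℝ × ℝ}
    (hv : v ∈ G.verts) {F : Set (ℝ × ℝ)} (hF : (G.deleteVerts {v}).IsFace F)
    (hbd : Bornology.IsBounded F) (hvF : v ∉ F) :
    ∃ a ∈ (G.deleteVerts {v}).verts, ∃ b ∈ (G.deleteVerts {v}).verts,
      ∃ c ∈ (G.deleteVerts {v}).verts, (G.deleteVerts {v}).Adj a b ∧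
        (G.deleteVerts {v}).Adj b c ∧ (G.deleteVerts {v}).Adj a c ∧ F = openTriangle a b c := by
  obtain ⟨a, ha, b, hb, c, hc, hab, hbc, hac, rfl⟩ :=
    hG.2.2 F (hG.isFace_of_notMem hv hF hvF) hbd
  have hsub := subset_closure_openTriangle hF.nonempty
  have hvd := hG.1.notMem_drawing_deleteVerts hv
  have hncl : v ∉ closure (openTriangle a b c) := by
    intro hcl
    obtain ⟨y, hy, hyF⟩ := mem_closure_iff.1 hcl _ (isFace_component hvd).isOpen
      (mem_connectedComponentIn hvd)
    rw [hF.eq_of_mem (isFace_component hvd) hyF hy] at hvF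
    exact hvF (mem_connectedComponentIn hvd)
  have hav : a ≠ v := by rintro rfl; exact hncl (hsub (subset_convexHull _ _ (by simp)))
  have hbv : b ≠ v := by rintro rfl; exact hncl (hsub (subset_convexHull _ _ (by simp)))
  have hcv : c ≠ v := by rintro rfl; exact hncl (hsub (subset_convexHull _ _ (by simp)))
  simp only [mem_deleteVerts, deleteVerts_adj]
  exact ⟨a, ⟨ha, hav⟩, b, ⟨hb, hbv⟩, c, ⟨hc, hcv⟩, ⟨hab, hav, hbv⟩, ⟨hbc, hbv, hcv⟩,
    ⟨hac, hav, hcv⟩, rfl⟩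

lemma not_isBounded_of_mem_closure {v : ℝ × ℝ}
    (hvO : v ∈ closure G.outerRegion) {F : Set (ℝ × ℝ)} (hF : (G.deleteVerts {v}).IsFace F)
    (hvF : v ∈ F) : ¬ Bornology.IsBounded F := by
  intro hb
  obtain ⟨y, hyF, hyO⟩ := mem_closure_iff.1 hvO _ hF.isOpen hvF
  refine hyO.2 (hb.subset ?_)
  rw [hF.eq_component hyF]
  exact component_subset_deleteVerts v y

lemma exists_mem_outerRegion {F : Set (ℝ × ℝ)} (hb : ¬ Bornology.IsBounded F) :
    ∃ y ∈ F, y ∈ G.outerRegion := by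
  obtain ⟨R, hR⟩ := G.isCompact_drawing.isBounded.subset_closedBall 0
  have hex : ∃ y ∈ F, y ∉ Metric.closedBall 0 (max R 0) := by
    by_contra! h
    exact hb (Metric.isBounded_closedBall.subset h)
  obtain ⟨y, hyF, hy⟩ := hex
  have hy' : max R 0 < ‖y‖ := by simpa using hy
  have hyR := (le_max_left R 0).trans_lt hy'
  have hy0 := (le_max_right R 0).trans_lt hy'
  set S := (fun s : ℝ => s • y) '' Set.Ici 1 with hS
  have hSc : IsPreconnected S := isPreconnected_Ici.image _ (by fun_prop)
  have hnorm : ∀ s : ℝ, 1 ≤ s → ‖s • y‖ = s * ‖y‖ := fun s hs => by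
    rw [norm_smul, Real.norm_of_nonneg (by linarith)]
  have hSd : S ⊆ G.drawingᶜ := by
    rintro _ ⟨s, hs, rfl⟩ hd
    have h1 := hR hd
    rw [mem_closedBall_zero_iff, hnorm s hs] at h1
    nlinarith [Set.mem_Ici.1 hs]
  have hyS : y ∈ S := ⟨1, by simp, one_smul _ _⟩
  refine ⟨y, hyF, hSd hyS, fun hbd => ?_⟩
  obtain ⟨M, hM⟩ := (hbd.subset (hSc.subset_connectedComponentIn hyS hSd)).exists_norm_le
  have h1 := hM _ ⟨max 1 ((M + 1) / ‖y‖), Set.mem_Ici.2 (le_max_left _ _), rfl⟩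
  dsimp only at h1
  rw [hnorm _ (le_max_left _ _)] at h1
  have h2 := mul_le_mul_of_nonneg_right (le_max_right 1 ((M + 1) / ‖y‖)) hy0.le
  rw [div_mul_cancel₀ _ hy0.ne'] at h2
  linarith

lemma mem_outerRegion_of_mem_closure {x : ℝ × ℝ} (hx : x ∉ G.drawing)
    (h : x ∈ closure G.outerRegion) : x ∈ G.outerRegion := by
  obtain ⟨y, hy, hyO⟩ := mem_closure_iff.1 h _ (isFace_component hx).isOpen
    (mem_connectedComponentIn hx)
  refine mem_outerRegion_of_component_eq hyO ?_
  rw [← connectedComponentIn_eq hy]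
  exact mem_connectedComponentIn hx

lemma IsEmbedded.mem_closure_of_spoke (hE : G.IsEmbedded) {v a : ℝ × ℝ} (ha : G.Adj v a) {t : ℝ}
    (h0 : 0 ≤ t) (h1 : t < 1) (h : v + t • (a - v) ∈ closure G.outerRegion) :
    v ∈ closure G.outerRegion := by
  rcases h0.eq_or_lt with rfl | h0
  · simpa using h
  have hav := G.symm _ _ ha
  rcases hE.leftStrip_subset_outerRegion ha h0 h1 h with h2 | h2
  · exact closure_mono h2 (hE.segment_subset_closure_leftStrip ha (left_mem_segment ℝ _ _))
  · exact closure_mono h2 (hE.segment_subset_closure_leftStrip hav (right_mem_segment ℝ _ _))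

lemma IsNearTriangulation.isBounded_of_notMem_closure (hG : G.IsNearTriangulation) {v : ℝ × ℝ}
    (hv : v ∈ G.verts) (hvO : v ∉ closure G.outerRegion) {F : Set (ℝ × ℝ)}
    (hF : (G.deleteVerts {v}).IsFace F) (hvF : v ∈ F) : Bornology.IsBounded F := by
  by_contra hb
  obtain ⟨y, hyF, hyO⟩ := exists_mem_outerRegion (G := G) hb
  have hcover : F ⊆ G.outerRegion ∪ (closure G.outerRegion)ᶜ := by
    intro x hx
    by_contra! h
    rw [Set.mem_union, not_or, Set.mem_compl_iff, not_not] at h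
    by_cases hxd : x ∈ G.drawing
    · obtain ⟨a, ha, t, h0, h1, rfl⟩ := hG.exists_spoke hv hxd (hF.notMem_drawing hx)
      exact hvO (hG.1.mem_closure_of_spoke ha h0 h1 h.2)
    · exact h.1 (mem_outerRegion_of_mem_closure hxd h.2)
  obtain ⟨z, -, hz, hz'⟩ := hF.isPreconnected G.outerRegion (closure G.outerRegion)ᶜ
    G.isOpen_outerRegion isClosed_closure.isOpen_compl hcover ⟨y, hyF, hyO⟩ ⟨v, hvF, hvO⟩
  exact hz' (subset_closure hz)

lemma IsTriFace.left_adj {w p q : ℝ × ℝ} (h : G.IsTriFace w p q) : G.Adj w p := h.1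

lemma IsTriFace.right_adj {w p q : ℝ × ℝ} (h : G.IsTriFace w p q) : G.Adj w q :=
  G.symm _ _ h.2.2.1

lemma IsTriFace.not_swap {w p q : ℝ × ℝ} (h : G.IsTriFace w p q) : ¬ G.IsTriFace w q p := by
  intro h'
  have h1 := h.2.2.2.1
  have h2 := h'.2.2.2.1
  have h3 : cross w q p = -cross w p q := by unfold cross; ring
  linarith

lemma IsEmbedded.triFace_unique_left (hE : G.IsEmbedded) {w p p' q : ℝ × ℝ}
    (h : G.IsTriFace w p q) (h' : G.IsTriFace w p' q) : p = p' :=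
  hE.triFace_unique h.rotate.rotate h'.rotate.rotate

lemma IsNearTriangulation.eq_of_no_succ (hG : G.IsNearTriangulation) {w p p' : ℝ × ℝ}
    (hp : G.Adj w p) (hp' : G.Adj w p') (h : ∀ q, ¬ G.IsTriFace w p q)
    (h' : ∀ q, ¬ G.IsTriFace w p' q) : p = p' := by
  have hmem := hG.mem_of_link_closed
    (A := {z | G.Adj w z ∧ Relation.ReflTransGen (G.IsTriFace w) z p}) (fun _ hz => hz.1)
    (fun x y hxy => ?_) ⟨hp, .refl⟩ hp'
  · rcases Relation.ReflTransGen.cases_head hmem.2 with e | ⟨q, hq, -⟩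
    · exact e.symm
    · exact absurd hq (h' q)
  · constructor
    · rintro ⟨-, hx⟩
      refine ⟨hxy.right_adj, ?_⟩
      rcases Relation.ReflTransGen.cases_head hx with rfl | ⟨q, hq, hqp⟩
      · exact absurd hxy (h y)
      · rwa [hG.1.triFace_unique hxy hq]
    · rintro ⟨-, hy⟩
      exact ⟨hxy.left_adj, hy.head hxy⟩

lemma IsNearTriangulation.eq_of_no_pred (hG : G.IsNearTriangulation) {w p p' : ℝ × ℝ}
    (hp : G.Adj w p) (hp' : G.Adj w p') (h : ∀ q, ¬ G.IsTriFace w q p)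
    (h' : ∀ q, ¬ G.IsTriFace w q p') : p = p' := by
  have hmem := hG.mem_of_link_closed
    (A := {z | G.Adj w z ∧ Relation.ReflTransGen (G.IsTriFace w) p z}) (fun _ hz => hz.1)
    (fun x y hxy => ?_) ⟨hp, .refl⟩ hp'
  · rcases Relation.ReflTransGen.cases_tail hmem.2 with e | ⟨q, -, hq⟩
    · exact e.symm
    · exact absurd hq (h' q)
  · constructor
    · rintro ⟨-, hx⟩
      exact ⟨hxy.right_adj, hx.tail hxy⟩
    · rintro ⟨-, hy⟩
      refine ⟨hxy.left_adj, ?_⟩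
      rcases Relation.ReflTransGen.cases_tail hy with rfl | ⟨q, hqp, hq⟩
      · exact absurd hxy (h x)
      · rwa [hG.1.triFace_unique_left hxy hq]

lemma IsNearTriangulation.exists_succ (hG : G.IsNearTriangulation) {w p : ℝ × ℝ}
    (hp : G.Adj w p) (hw : w ∉ closure G.outerRegion) : ∃ q, G.IsTriFace w p q :=
  (hG.exists_triFace hp).resolve_left fun h =>
    hw (closure_mono h (hG.1.segment_subset_closure_leftStrip hp (left_mem_segment ℝ _ _)))

lemma IsNearTriangulation.exists_pred (hG : G.IsNearTriangulation) {w p : ℝ × ℝ}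
    (hp : G.Adj w p) (hw : w ∉ closure G.outerRegion) : ∃ q, G.IsTriFace w q p := by
  have hp' := G.symm _ _ hp
  obtain ⟨q, hq⟩ := (hG.exists_triFace hp').resolve_left fun h =>
    hw (closure_mono h (hG.1.segment_subset_closure_leftStrip hp' (right_mem_segment ℝ _ _)))
  exact ⟨q, hq.rotate⟩

lemma IsEmbedded.no_triFace_of_leftStrip (hE : G.IsEmbedded) {w p q : ℝ × ℝ}
    (h : G.leftStrip w p ⊆ G.outerRegion) : ¬ G.IsTriFace w p q := by
  intro ht
  obtain ⟨x, hx⟩ := hE.leftStrip_nonempty ht.1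
  exact ht.notMem_outerRegion (hE.leftStrip_subset_triFace ht hx) (h hx)

/-- An edge on the outer boundary has no inner face on one of its sides. -/
lemma IsEmbedded.no_succ_or_no_pred (hE : G.IsEmbedded) {w p : ℝ × ℝ} (hp : G.Adj w p)
    (h : segment ℝ w p ⊆ closure G.outerRegion) :
    (∀ q, ¬ G.IsTriFace w p q) ∨ (∀ q, ¬ G.IsTriFace w q p) := by
  rcases hE.leftStrip_subset_outerRegion hp (t := 1 / 2) (by norm_num) (by norm_num)
    (h (edge_point_mem_segment (by norm_num) (by norm_num))) with h | h
  · exact Or.inl fun q => hE.no_triFace_of_leftStrip h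
  · exact Or.inr fun q hq => hE.no_triFace_of_leftStrip h hq.rotate.rotate

lemma IsNearTriangulation.triFace_of_deleteVerts (hG : G.IsNearTriangulation) {v w p q : ℝ × ℝ}
    (hv : v ∈ G.verts) (hvO : v ∈ closure G.outerRegion)
    (h : (G.deleteVerts {v}).IsTriFace w p q) : G.IsTriFace w p q := by
  obtain ⟨h1, h2, h3, h4, h5⟩ := h
  exact ⟨h1.1, h2.1, h3.1, h4, hG.isFace_of_notMem hv h5 fun hvF =>
    not_isBounded_of_mem_closure hvO h5 hvF (isBounded_openTriangle _ _ _)⟩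

lemma IsNearTriangulation.false_of_triFaces (hG : G.IsNearTriangulation) {v w x y z : ℝ × ℝ}
    (hG' : (G.deleteVerts {v}).IsNearTriangulation) (hvO : v ∈ closure G.outerRegion)
    (hx : G.IsTriFace v w x) (hy : G.IsTriFace v y w) (hz : G.Adj w z) (hzv : z ≠ v)
    (h : (∀ q, ¬ G.IsTriFace w z q) ∨ (∀ q, ¬ G.IsTriFace w q z)) : False := by
  have hv := (G.mem_of_adj _ _ hx.1).1
  have hwv := (Adj.ne hx.left_adj).symm
  have hx' := hx.rotate
  have hy' := hy.rotate.rotate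
  have hz' : (G.deleteVerts {v}).Adj w z := deleteVerts_adj.2 ⟨hz, hwv, hzv⟩
  rcases h with h | h
  · have e : z = x := by
      refine hG'.eq_of_no_succ hz' (deleteVerts_adj.2 ⟨hx'.left_adj, hwv,
        (Adj.ne hx.right_adj).symm⟩) (fun q hq => h q (hG.triFace_of_deleteVerts hv hvO hq)) ?_
      intro q hq
      have e := hG.1.triFace_unique (hG.triFace_of_deleteVerts hv hvO hq) hx'
      exact (deleteVerts_adj.1 hq.right_adj).2.2 e
    exact h v (e ▸ hx')
  · have e : z = y := by
      refine hG'.eq_of_no_pred hz' (deleteVerts_adj.2 ⟨hy'.right_adj, hwv,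
        (Adj.ne hy.left_adj).symm⟩) (fun q hq => h q (hG.triFace_of_deleteVerts hv hvO hq)) ?_
      intro q hq
      have e := hG.1.triFace_unique_left (hG.triFace_of_deleteVerts hv hvO hq) hy'
      exact (deleteVerts_adj.1 hq.left_adj).2.2 e
    exact h v (e ▸ hy')

lemma IsNearTriangulation.exists_link_triple (hG : G.IsNearTriangulation) {v : ℝ × ℝ}
    (hv : v ∈ G.verts) (hvO : v ∉ closure G.outerRegion) :
    ∃ p q r, G.IsTriFace v p q ∧ G.IsTriFace v r p ∧ ({p, q, r} : Finset (ℝ × ℝ)).card = 3 ∧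
      {p, q, r} ⊆ G.verts.filter (fun w => G.Adj v w) := by
  obtain ⟨p, hp⟩ := hG.2.1.exists_adj hv
  obtain ⟨q, hq⟩ := hG.exists_succ hp hvO
  obtain ⟨r, hr⟩ := hG.exists_pred hp hvO
  have hqr : q ≠ r := by
    rintro rfl
    exact hq.not_swap hr
  refine ⟨p, q, r, hq, hr, Finset.card_eq_three.2
    ⟨p, q, r, Adj.ne hq.2.1, (Adj.ne hr.2.1).symm, hqr, rfl⟩, fun x hx => ?_⟩
  simp only [Finset.mem_insert, Finset.mem_singleton] at hx
  rw [Finset.mem_filter]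
  rcases hx with rfl | rfl | rfl
  · exact ⟨(G.mem_of_adj _ _ hp).2, hp⟩
  · exact ⟨(G.mem_of_adj _ _ hq.right_adj).2, hq.right_adj⟩
  · exact ⟨(G.mem_of_adj _ _ hr.left_adj).2, hr.left_adj⟩

lemma IsNearTriangulation.degree_eq_three (hG : G.IsNearTriangulation) {v : ℝ × ℝ}
    (hG' : (G.deleteVerts {v}).IsNearTriangulation) (hv : v ∈ G.verts)
    (hvO : v ∉ closure G.outerRegion) : G.degree v = 3 := by
  obtain ⟨p, q, r, -, -, hcard, hsub⟩ := hG.exists_link_triple hv hvO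
  refine le_antisymm ?_ (hcard ▸ Finset.card_le_card hsub)
  have hvd := hG.1.notMem_drawing_deleteVerts hv
  have hF := isFace_component hvd
  have hvF : v ∈ connectedComponentIn (G.deleteVerts {v}).drawingᶜ v :=
    mem_connectedComponentIn hvd
  obtain ⟨a, -, b, -, c, -, hab, hbc, hac, heq⟩ :=
    hG'.2.2 _ hF (hG.isBounded_of_notMem_closure hv hvO hF hvF)
  refine le_trans (Finset.card_le_card (t := {a, b, c}) fun x hx => ?_) Finset.card_le_three
  obtain ⟨hxv, hx⟩ := Finset.mem_filter.1 hx
  have hxc := hG.1.closure_face_of_adj hx hF hvF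
  have hxd := hG.2.1.mem_drawing_deleteVerts hv hxv (Adj.ne hx).symm
  have hxF := fun h => hF.notMem_drawing (x := x) h hxd
  rw [heq] at hxc hxF hvF
  simpa using eq_corner_of_mem_closure hG'.1 hab hbc hac ⟨v, hvF⟩
    (mem_deleteVerts.2 ⟨hxv, (Adj.ne hx).symm⟩) hxc hxF

lemma Reachable.symm {p q : ℝ × ℝ} (h : G.Reachable p q) : G.Reachable q p :=
  have : Std.Symm G.Adj := ⟨G.symm⟩
  (Relation.ReflTransGen.stdSymm (r := G.Adj)).symm _ _ h

lemma deleteVerts_comm (G : PlaneGraph) (v x : ℝ × ℝ) :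
    (G.deleteVerts {v}).deleteVerts {x} = (G.deleteVerts {x}).deleteVerts {v} := by
  have h1 : (G.verts \ {v}) \ {x} = (G.verts \ {x}) \ {v} := sdiff_right_comm _ _ _
  have h2 : (fun p q => (G.Adj p q ∧ p ∉ ({v} : Finset (ℝ × ℝ)) ∧ q ∉ ({v} : Finset (ℝ × ℝ))) ∧
      p ∉ ({x} : Finset (ℝ × ℝ)) ∧ q ∉ ({x} : Finset (ℝ × ℝ))) =
      (fun p q => (G.Adj p q ∧ p ∉ ({x} : Finset (ℝ × ℝ)) ∧ q ∉ ({x} : Finset (ℝ × ℝ))) ∧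
      p ∉ ({v} : Finset (ℝ × ℝ)) ∧ q ∉ ({v} : Finset (ℝ × ℝ))) := by
    ext p q
    tauto
  simp only [deleteVerts, h1, h2]

/-- Deleting a vertex whose neighbours stay mutually reachable preserves connectedness. -/
lemma Connected.deleteVerts (hG : G.Connected) {v : ℝ × ℝ}
    (hne : (G.deleteVerts {v}).verts.Nonempty)
    (hn : ∀ p q, G.Adj v p → G.Adj v q → (G.deleteVerts {v}).Reachable p q) :
    (G.deleteVerts {v}).Connected := by
  refine ⟨hne, fun p hp q hq => ?_⟩
  rw [mem_deleteVerts] at hp hq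
  have key : ∀ y, G.Reachable p y → (y ≠ v → (G.deleteVerts {v}).Reachable p y) ∧
      (y = v → ∃ y', G.Adj v y' ∧ (G.deleteVerts {v}).Reachable p y') := by
    intro y hy
    induction hy with
    | refl => exact ⟨fun _ => .refl, fun h => absurd h hp.2⟩
    | @tail y z _ hyz ih =>
      refine ⟨fun hz => ?_, ?_⟩
      · by_cases hyv : y = v
        · obtain ⟨y', hy', hr⟩ := ih.2 hyv
          exact hr.trans (hn y' z hy' (hyv ▸ hyz))
        · exact (ih.1 hyv).tail (deleteVerts_adj.2 ⟨hyz, hyv, hz⟩)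
      · rintro rfl
        exact ⟨y, G.symm _ _ hyz, ih.1 (Adj.ne hyz)⟩
  exact (key q (hG.2 p hp.1 q hq.1)).1 hq.2

lemma Biconnected.deleteVerts (hG : G.Biconnected) {v : ℝ × ℝ} (hv : v ∈ G.verts)
    (hc : 4 ≤ G.verts.card)
    (hn : ∀ x p q, x ≠ v → (G.deleteVerts {x}).Adj v p → (G.deleteVerts {x}).Adj v q →
      ((G.deleteVerts {x}).deleteVerts {v}).Reachable p q) :
    (G.deleteVerts {v}).Biconnected := by
  refine ⟨by rw [card_deleteVerts hv]; omega, hG.2.2 v hv, fun x hx => ?_⟩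
  have hx' := mem_deleteVerts.1 hx
  have hcard : ((G.deleteVerts {v}).deleteVerts {x}).verts.card = G.verts.card - 1 - 1 := by
    rw [card_deleteVerts hx, card_deleteVerts hv]
  have hne : ((G.deleteVerts {v}).deleteVerts {x}).verts.Nonempty := by
    rw [← Finset.card_pos]
    omega
  rw [deleteVerts_comm] at hne ⊢
  exact (hG.2.2 x hx'.1).deleteVerts hne fun p q => hn x p q hx'.2

/-- If the neighbours of `x` in the link of `v` can be joined avoiding `v` and `x`, then so can
all neighbours of `v`. -/
lemma IsNearTriangulation.reachable_of_link (hG : G.IsNearTriangulation) {v x p q : ℝ × ℝ}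
    (hlink : ∀ r s, (G.IsTriFace v x r ∨ G.IsTriFace v r x) →
      (G.IsTriFace v x s ∨ G.IsTriFace v s x) →
      ((G.deleteVerts {x}).deleteVerts {v}).Reachable r s)
    (hp : (G.deleteVerts {x}).Adj v p) (hq : (G.deleteVerts {x}).Adj v q) :
    ((G.deleteVerts {x}).deleteVerts {v}).Reachable p q := by
  rw [deleteVerts_adj] at hp hq
  set H := (G.deleteVerts {x}).deleteVerts {v} with hH
  have hstep : ∀ y z, (G.IsTriFace v y z ∨ G.IsTriFace v z y) →
      (G.Adj v y ∧ ((y ≠ x ∧ H.Reachable p y) ∨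
        (y = x ∧ ∃ r, (G.IsTriFace v x r ∨ G.IsTriFace v r x) ∧ H.Reachable p r))) →
      (G.Adj v z ∧ ((z ≠ x ∧ H.Reachable p z) ∨
        (z = x ∧ ∃ r, (G.IsTriFace v x r ∨ G.IsTriFace v r x) ∧ H.Reachable p r))) := by
    rintro y z hyz ⟨hy, hy'⟩
    have hvz : G.Adj v z := hyz.elim (·.right_adj) (·.left_adj)
    have hyz' : G.Adj y z := hyz.elim (·.2.1) (fun h => G.symm _ _ h.2.1)
    refine ⟨hvz, ?_⟩
    rcases hy' with ⟨hyx, hr⟩ | ⟨rfl, r, hr, hpr⟩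
    · by_cases hzx : z = x
      · subst hzx
        exact Or.inr ⟨rfl, y, hyz.symm, hr⟩
      · exact Or.inl ⟨hzx, hr.tail (deleteVerts_adj.2
          ⟨deleteVerts_adj.2 ⟨hyz', hyx, hzx⟩, (Adj.ne hy).symm, (Adj.ne hvz).symm⟩)⟩
    · exact Or.inl ⟨(Adj.ne hyz').symm, hpr.trans (hlink r z hr hyz)⟩
  have hmem := hG.mem_of_link_closed
    (A := {y | G.Adj v y ∧ ((y ≠ x ∧ H.Reachable p y) ∨
        (y = x ∧ ∃ r, (G.IsTriFace v x r ∨ G.IsTriFace v r x) ∧ H.Reachable p r))})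
    (fun _ h => h.1) (fun y z h => ⟨hstep y z (Or.inl h), hstep z y (Or.inr h)⟩)
    ⟨hp.1, Or.inl ⟨hp.2.2, .refl⟩⟩ hq.1
  rcases hmem.2 with h | h
  · exact h.2
  · exact absurd h.1 hq.2.2

/-- The two neighbours of `v` in the link of a vertex `x` off the outer face can be joined
avoiding `v` and `x`. -/
lemma IsNearTriangulation.reachable_link_nbrs (hG : G.IsNearTriangulation) {v x r s : ℝ × ℝ}
    (hx : x ∉ closure G.outerRegion) (hr : G.IsTriFace x v r) (hs : G.IsTriFace x s v) :
    ((G.deleteVerts {x}).deleteVerts {v}).Reachable r s := by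
  set H := (G.deleteVerts {x}).deleteVerts {v} with hH
  have hex : ∀ z, G.Adj x z → ∃ q, G.IsTriFace x z q := fun z hz => hG.exists_succ hz hx
  choose! f hf using hex
  by_contra hcon
  set A := G.verts.filter (fun z => G.Adj x z ∧ z ≠ v ∧ H.Reachable r z) with hA
  have hmem : ∀ z, z ∈ A ↔ G.Adj x z ∧ z ≠ v ∧ H.Reachable r z := fun z =>
    ⟨fun h => (Finset.mem_filter.1 h).2,
      fun h => Finset.mem_filter.2 ⟨(G.mem_of_adj _ _ h.1).2, h⟩⟩
  have hmaps : Set.MapsTo f A A := by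
    intro z hz
    rw [Finset.mem_coe, hmem] at hz ⊢
    have hfz := hf z hz.1
    have hne : f z ≠ v := by
      intro e
      rw [e] at hfz
      exact hcon (hG.1.triFace_unique_left hfz hs ▸ hz.2.2)
    refine ⟨hfz.right_adj, hne, hz.2.2.tail (deleteVerts_adj.2
      ⟨deleteVerts_adj.2 ⟨hfz.2.1, (Adj.ne hz.1).symm, (Adj.ne hfz.right_adj).symm⟩, hz.2.1,
        hne⟩)⟩
  have hinj : Set.InjOn f A := by
    intro y hy z hz e
    rw [Finset.mem_coe, hmem] at hy hz
    exact hG.1.triFace_unique_left (hf y hy.1) (e ▸ hf z hz.1)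
  have hrA : r ∈ A := (hmem r).2 ⟨hr.right_adj, (Adj.ne hr.2.1).symm, .refl⟩
  obtain ⟨z, hz, hzr⟩ := Finset.surjOn_of_injOn_of_card_le f hmaps hinj le_rfl hrA
  rw [Finset.mem_coe, hmem] at hz
  exact hz.2.1 (hG.1.triFace_unique_left (hzr ▸ hf z hz.1) hr)

lemma IsNearTriangulation.link_of_degree_eq_three (hG : G.IsNearTriangulation) {v : ℝ × ℝ}
    (hv : v ∈ G.verts) (hvO : v ∉ closure G.outerRegion) (hd : G.degree v = 3) :
    ∃ a b c, G.IsTriFace v a b ∧ G.IsTriFace v b c ∧ G.IsTriFace v c a ∧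
      ∀ y, G.Adj v y → y = a ∨ y = b ∨ y = c := by
  obtain ⟨p, q, r, hq, hr, hcard, hsub⟩ := hG.exists_link_triple hv hvO
  have heq := Finset.eq_of_subset_of_card_le hsub (by rw [hcard]; exact hd.le)
  have hall : ∀ y, G.Adj v y → y = p ∨ y = q ∨ y = r := by
    intro y hy
    have : y ∈ ({p, q, r} : Finset (ℝ × ℝ)) := by
      rw [heq]
      exact Finset.mem_filter.2 ⟨(G.mem_of_adj _ _ hy).2, hy⟩
    simpa using this
  refine ⟨p, q, r, hq, ?_, hr, hall⟩
  obtain ⟨s, hs⟩ := hG.exists_succ hq.right_adj hvO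
  rcases hall s hs.right_adj with rfl | rfl | rfl
  · exact absurd hs hq.not_swap
  · exact absurd rfl (Adj.ne hs.2.1)
  · exact hs

lemma mem_openTriangle_or_mem_segment {v a b c x : ℝ × ℝ} (h1 : 0 < cross v a b)
    (h2 : 0 < cross v b c) (h3 : 0 < cross v c a) (hab : 0 < cross a b x) (hbc : 0 < cross b c x)
    (hca : 0 < cross c a x) (h : cross v a x = 0) :
    x ∈ openTriangle v b c ∨ x ∈ segment ℝ v a := by
  have e1 : cross b v x = -cross v b x := cross_swap v b x
  have e2 : cross c v x = -cross v c x := cross_swap v c x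
  have e3 : cross a v x = -cross v a x := cross_swap v a x
  by_cases hb : cross v b x ≤ 0
  · exact Or.inr (mem_segment_of_cross h1 h hab.le (by linarith))
  by_cases hc : 0 ≤ cross v c x
  · right
    rw [segment_symm]
    exact mem_segment_of_cross (c := c) (by rwa [cross_rotate c a v, cross_rotate v c a])
      (by linarith) hc hca.le
  · exact Or.inl ((mem_openTriangle_iff h2 x).2 ⟨by linarith, hbc, by linarith⟩)

/-- The three triangles spanned by `v` and the sides of a triangle around `v`, together with the
three spokes, cover that triangle. -/
lemma openTriangle_subset_star {v a b c x : ℝ × ℝ} (h1 : 0 < cross v a b)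
    (h2 : 0 < cross v b c) (h3 : 0 < cross v c a) (hab : 0 < cross a b x) (hbc : 0 < cross b c x)
    (hca : 0 < cross c a x) :
    (x ∈ openTriangle v a b ∨ x ∈ openTriangle v b c ∨ x ∈ openTriangle v c a) ∨
      x ∈ segment ℝ v a ∨ x ∈ segment ℝ v b ∨ x ∈ segment ℝ v c := by
  have e1 : cross b v x = -cross v b x := cross_swap v b x
  have e2 : cross c v x = -cross v c x := cross_swap v c x
  have e3 : cross a v x = -cross v a x := cross_swap v a x
  have hsum : cross v b c * cross v a x + cross v c a * cross v b x +
      cross v a b * cross v c x = 0 := by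
    unfold cross; ring
  by_cases ha : cross v a x = 0
  · rcases mem_openTriangle_or_mem_segment h1 h2 h3 hab hbc hca ha with h | h <;> tauto
  by_cases hb : cross v b x = 0
  · rcases mem_openTriangle_or_mem_segment h2 h3 h1 hbc hca hab hb with h | h <;> tauto
  by_cases hc : cross v c x = 0
  · rcases mem_openTriangle_or_mem_segment h3 h1 h2 hca hab hbc hc with h | h <;> tauto
  left
  rw [mem_openTriangle_iff h1, mem_openTriangle_iff h2, mem_openTriangle_iff h3]
  by_contra! hcon
  obtain ⟨hc1, hc2, hc3⟩ := hcon
  rcases lt_or_gt_of_ne ha with ha₁ | ha₁ <;> rcases lt_or_gt_of_ne hb with hb₁ | hb₁ <;>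
    rcases lt_or_gt_of_ne hc with hc₁ | hc₁
  · nlinarith [mul_pos h2 (neg_pos.2 ha₁), mul_pos h3 (neg_pos.2 hb₁), mul_pos h1 (neg_pos.2 hc₁)]
  · linarith [hc3 hc₁ hca]
  · linarith [hc2 hb₁ hbc]
  · linarith [hc3 hc₁ hca]
  · linarith [hc1 ha₁ hab]
  · linarith [hc1 ha₁ hab]
  · linarith [hc2 hb₁ hbc]
  · nlinarith [mul_pos h2 ha₁, mul_pos h3 hb₁, mul_pos h1 hc₁]

/-- Deleting a vertex of degree three with three inner faces around it merges them into one
triangular face. -/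
lemma IsNearTriangulation.face_eq_openTriangle (hG : G.IsNearTriangulation) {v a b c : ℝ × ℝ}
    (h1 : G.IsTriFace v a b) (h2 : G.IsTriFace v b c) (h3 : G.IsTriFace v c a)
    {F : Set (ℝ × ℝ)} (hF : (G.deleteVerts {v}).IsFace F) (hvF : v ∈ F) :
    F = openTriangle a b c := by
  have p1 := h1.2.2.2.1
  have p2 := h2.2.2.2.1
  have p3 := h3.2.2.2.1
  have hsum : cross a b c = cross v a b + cross v b c + cross v c a := by
    unfold cross; ring
  have hpos : 0 < cross a b c := by linarith
  have hvT : v ∈ openTriangle a b c := by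
    rw [mem_openTriangle_iff hpos, cross_rotate v a b, cross_rotate v b c, cross_rotate v c a]
    exact ⟨p1, p2, p3⟩
  have hdis : Disjoint (openTriangle a b c) (G.deleteVerts {v}).drawing := by
    rw [Set.disjoint_left]
    intro x hx hxd
    have hxG := drawing_deleteVerts_subset v hxd
    have hspoke : ∀ y, G.Adj v y → x ∈ segment ℝ v y → x = y := by
      intro y hy hxy
      rw [segment_eq_image'] at hxy
      obtain ⟨t, ⟨h0, ht⟩, rfl⟩ := hxy
      rcases ht.eq_or_lt with rfl | ht
      · simp
      · exact absurd hxd (hG.1.spoke_notMem_drawing hy h0 ht)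
    obtain ⟨q1, q2, q3⟩ := (mem_openTriangle_iff hpos x).1 hx
    rcases openTriangle_subset_star p1 p2 p3 q1 q2 q3 with (h | h | h) | h | h | h
    · exact h1.2.2.2.2.notMem_drawing h hxG
    · exact h2.2.2.2.2.notMem_drawing h hxG
    · exact h3.2.2.2.2.notMem_drawing h hxG
    · rw [hspoke a h1.left_adj h, cross_self_outer] at q1
      exact lt_irrefl _ q1
    · rw [hspoke b h2.left_adj h, cross_self_right] at q1
      exact lt_irrefl _ q1
    · rw [hspoke c h3.left_adj h, cross_self_right] at q2
      exact lt_irrefl _ q2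
  refine Set.Subset.antisymm ?_ (hF.subset_of_isPreconnected
    (convex_openTriangle a b c).isPreconnected hdis hvT hvF)
  refine hF.isPreconnected.subset_of_closure_inter_subset (isOpen_openTriangle a b c)
    ⟨v, hvF, hvT⟩ ?_
  rintro x ⟨hxc, hxF⟩
  by_contra hxT
  apply hF.notMem_drawing hxF
  have ha := (Adj.ne h1.left_adj).symm
  have hb := (Adj.ne h2.left_adj).symm
  have hc := (Adj.ne h3.left_adj).symm
  rcases openTriangle_boundary ⟨v, hvT⟩ hxc hxT with h | h | h
  · exact segment_subset_drawing (deleteVerts_adj.2 ⟨h1.2.1, ha, hb⟩) h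
  · exact segment_subset_drawing (deleteVerts_adj.2 ⟨h2.2.1, hb, hc⟩) h
  · exact segment_subset_drawing (deleteVerts_adj.2 ⟨G.symm _ _ h3.2.1, ha, hc⟩) h

lemma IsNearTriangulation.deleteVerts_interior (hG : G.IsNearTriangulation)
    (hc : 4 ≤ G.verts.card) {v : ℝ × ℝ} (hv : v ∈ G.verts) (hvO : v ∉ closure G.outerRegion)
    (hd : G.degree v = 3) : (G.deleteVerts {v}).IsNearTriangulation := by
  obtain ⟨a, b, c, h1, h2, h3, hN⟩ := hG.link_of_degree_eq_three hv hvO hd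
  have ha := (Adj.ne h1.left_adj).symm
  have hb := (Adj.ne h2.left_adj).symm
  have hcv := (Adj.ne h3.left_adj).symm
  refine ⟨hG.1.deleteVerts v, hG.2.1.deleteVerts hv hc ?_, ?_⟩
  · intro x p q _ hp hq
    rw [deleteVerts_adj] at hp hq
    by_cases hpq : p = q
    · subst hpq
      exact .refl
    have hadj : G.Adj p q := by
      have hab := h1.2.1
      have hbc := h2.2.1
      have hca := h3.2.1
      have hs := G.symm
      rcases hN p hp.1 with rfl | rfl | rfl <;> rcases hN q hq.1 with rfl | rfl | rfl <;>
        first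
        | assumption
        | exact absurd rfl hpq
        | exact hs _ _ ‹_›
    exact .single (deleteVerts_adj.2 ⟨deleteVerts_adj.2 ⟨hadj, hp.2.2, hq.2.2⟩,
      (Adj.ne hp.1).symm, (Adj.ne hq.1).symm⟩)
  · intro F hF hb'
    by_cases hvF : v ∈ F
    · refine ⟨a, ?_, b, ?_, c, ?_, ?_, ?_, ?_, hG.face_eq_openTriangle h1 h2 h3 hF hvF⟩
      · exact mem_deleteVerts.2 ⟨(G.mem_of_adj _ _ h1.left_adj).2, ha⟩
      · exact mem_deleteVerts.2 ⟨(G.mem_of_adj _ _ h2.left_adj).2, hb⟩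
      · exact mem_deleteVerts.2 ⟨(G.mem_of_adj _ _ h3.left_adj).2, hcv⟩
      · exact deleteVerts_adj.2 ⟨h1.2.1, ha, hb⟩
      · exact deleteVerts_adj.2 ⟨h2.2.1, hb, hcv⟩
      · exact deleteVerts_adj.2 ⟨G.symm _ _ h3.2.1, ha, hcv⟩
    · exact hG.exists_triangle_of_notMem hv hF hb' hvF

/-- A vertex on the outer boundary can be deleted if every neighbour of it on the outer boundary
is joined to it by an edge of the outer boundary. -/
lemma IsNearTriangulation.deleteVerts_boundary (hG : G.IsNearTriangulation)
    (hc : 4 ≤ G.verts.card) {v : ℝ × ℝ} (hv : v ∈ G.verts) (hvO : v ∈ closure G.outerRegion)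
    (hN : ∀ x, G.Adj v x → x ∈ closure G.outerRegion →
      segment ℝ v x ⊆ closure G.outerRegion) :
    (G.deleteVerts {v}).IsNearTriangulation := by
  refine ⟨hG.1.deleteVerts v, hG.2.1.deleteVerts hv hc ?_, ?_⟩
  · intro x p q hxv hp hq
    refine hG.reachable_of_link ?_ hp hq
    intro r s hr hs
    have hvx : G.Adj v x := hr.elim (·.left_adj) (·.right_adj)
    by_cases hx : x ∈ closure G.outerRegion
    · have hrs : r = s := by
        rcases hG.1.no_succ_or_no_pred hvx (hN x hvx hx) with h | h
        · exact hG.1.triFace_unique_left (hr.resolve_left (h r)) (hs.resolve_left (h s))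
        · exact hG.1.triFace_unique (hr.resolve_right (h r)) (hs.resolve_right (h s))
      rw [hrs]
      exact .refl
    · rcases hr with hr | hr <;> rcases hs with hs | hs
      · rw [hG.1.triFace_unique hr hs]
        exact .refl
      · exact (hG.reachable_link_nbrs hx hs.rotate.rotate hr.rotate).symm
      · exact hG.reachable_link_nbrs hx hr.rotate.rotate hs.rotate
      · rw [hG.1.triFace_unique_left hr hs]
        exact .refl
  · intro F hF hb
    exact hG.exists_triangle_of_notMem hv hF hb fun hvF =>
      not_isBounded_of_mem_closure hvO hF hvF hb

namespace IsBoundaryCycle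

variable {h : ℕ} {u : ZMod h → ℝ × ℝ}

lemma segment_succ_subset (hu : G.IsBoundaryCycle u) (i : ZMod h) :
    segment ℝ (u i) (u (i + 1)) ⊆ closure G.outerRegion :=
  (hu.2.2.2.2.1 i).trans frontier_subset_closure

lemma segment_pred_subset (hu : G.IsBoundaryCycle u) (i : ZMod h) :
    segment ℝ (u i) (u (i - 1)) ⊆ closure G.outerRegion := by
  rw [segment_symm]
  simpa using hu.segment_succ_subset (i - 1)

lemma adj_pred (hu : G.IsBoundaryCycle u) (i : ZMod h) : G.Adj (u i) (u (i - 1)) := by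
  have := hu.2.2.2.1 (i - 1)
  rw [sub_add_cancel] at this
  exact G.symm _ _ this

lemma mem_range_iff (hu : G.IsBoundaryCycle u) (hG : G.Biconnected) {v : ℝ × ℝ}
    (hv : v ∈ G.verts) : v ∈ Set.range u ↔ v ∈ closure G.outerRegion := by
  constructor
  · rintro ⟨i, rfl⟩
    exact hu.segment_succ_subset i (left_mem_segment ℝ _ _)
  · intro hvO
    exact hu.2.2.2.2.2 v hv ((mem_frontier_outerRegion_iff (hG.mem_drawing hv)).2 hvO)

lemma succ_ne_pred (hu : G.IsBoundaryCycle u) (i : ZMod h) : u (i + 1) ≠ u (i - 1) := by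
  intro e
  have e1 := hu.2.1 e
  have h2 : ((2 : ℕ) : ZMod h) = 0 := by
    push_cast
    linear_combination e1
  rw [ZMod.natCast_eq_zero_iff] at h2
  have := Nat.le_of_dvd (by norm_num) h2
  have := hu.1
  omega

lemma degreeOn_eq_two_iff (hu : G.IsBoundaryCycle u) (i : ZMod h) :
    G.degreeOn (Set.range u) (u i) = 2 ↔
      ∀ w, G.Adj (u i) w → w ∈ Set.range u → w = u (i + 1) ∨ w = u (i - 1) := by
  have hcard : ({u (i + 1), u (i - 1)} : Finset (ℝ × ℝ)).card = 2 :=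
    Finset.card_pair (hu.succ_ne_pred i)
  have hsub : ({u (i + 1), u (i - 1)} : Finset (ℝ × ℝ)) ⊆
      G.verts.filter (fun w => G.Adj (u i) w ∧ w ∈ Set.range u) := by
    intro x hx
    rw [Finset.mem_insert, Finset.mem_singleton] at hx
    rw [Finset.mem_filter]
    rcases hx with rfl | rfl
    · exact ⟨hu.2.2.1 _, hu.2.2.2.1 i, _, rfl⟩
    · exact ⟨hu.2.2.1 _, hu.adj_pred i, _, rfl⟩
  constructor
  · intro hd w hw hwr
    have heq := Finset.eq_of_subset_of_card_le hsub (by rw [hcard]; exact hd.le)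
    have : w ∈ ({u (i + 1), u (i - 1)} : Finset (ℝ × ℝ)) := by
      rw [heq]
      exact Finset.mem_filter.2 ⟨(G.mem_of_adj _ _ hw).2, hw, hwr⟩
    simpa using this
  · intro hall
    rw [← hcard]
    refine congrArg Finset.card (Finset.Subset.antisymm (fun w hw => ?_) hsub)
    obtain ⟨-, hw, hwr⟩ := Finset.mem_filter.1 hw
    simpa using hall w hw hwr

/-- If deleting a boundary vertex leaves a near-triangulation, its only neighbours on the
boundary are the two next to it. -/
lemma eq_succ_or_pred (hu : G.IsBoundaryCycle u) (hG : G.IsNearTriangulation) (i : ZMod h)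
    (hG' : (G.deleteVerts {u i}).IsNearTriangulation) {w : ℝ × ℝ} (hw : G.Adj (u i) w)
    (hwr : w ∈ Set.range u) : w = u (i + 1) ∨ w = u (i - 1) := by
  by_contra! hne
  have hs := hu.2.2.2.1 i
  have hp := hu.adj_pred i
  have hsp := hu.succ_ne_pred i
  have hs' := hG.1.no_succ_or_no_pred hs (hu.segment_succ_subset i)
  have hp' := hG.1.no_succ_or_no_pred hp (hu.segment_pred_subset i)
  have hboth : (∃ x, G.IsTriFace (u i) w x) ∧ ∃ y, G.IsTriFace (u i) y w := by
    constructor <;> by_contra! hcon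
    · rcases hs' with h1 | h1
      · exact hne.1 (hG.eq_of_no_succ hw hs hcon h1)
      · rcases hp' with h2 | h2
        · exact hne.2 (hG.eq_of_no_succ hw hp hcon h2)
        · exact hsp (hG.eq_of_no_pred hs hp h1 h2)
    · rcases hs' with h1 | h1
      · rcases hp' with h2 | h2
        · exact hsp (hG.eq_of_no_succ hs hp h1 h2)
        · exact hne.2 (hG.eq_of_no_pred hw hp hcon h2)
      · exact hne.1 (hG.eq_of_no_pred hw hs hcon h1)
  obtain ⟨⟨x, hx⟩, y, hy⟩ := hboth
  obtain ⟨j, rfl⟩ := hwr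
  refine hG.false_of_triFaces hG' (hu.segment_succ_subset i (left_mem_segment ℝ _ _)) hx hy
    (hu.2.2.2.1 j) ?_ (hG.1.no_succ_or_no_pred (hu.2.2.2.1 j) (hu.segment_succ_subset j))
  intro e
  apply hne.2
  rw [← hu.2.1 e, add_sub_cancel_right]

end IsBoundaryCycle

end PlaneGraph

/-- Let `T` be a near-triangulation of order `n ≥ 4` with boundary cycle `C`
and let `v` be a vertex of `T`.  Then `T − {v}` is a near-triangulation if and only if either
`v` is an interior vertex of degree 3 in `T`, or `v` is a boundary vertex whose degree in the
induced subgraph `T[C]` is 2. -/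
theorem deleteVert_isNearTriangulation_iff (T : PlaneGraph) (h : ℕ) (u : ZMod h → ℝ × ℝ)
    (v : ℝ × ℝ) (hT : T.IsNearTriangulation) (hu : T.IsBoundaryCycle u)
    (hn : 4 ≤ T.verts.card) (hv : v ∈ T.verts) :
    (T.deleteVerts {v}).IsNearTriangulation ↔
      ((T.IsInteriorVtx u v ∧ T.degree v = 3) ∨
        (v ∈ Set.range u ∧ T.degreeOn (Set.range u) v = 2)) := by
  have hr : ∀ {x}, x ∈ T.verts → (x ∈ Set.range u ↔ x ∈ closure T.outerRegion) :=
    fun hx => hu.mem_range_iff hT.2.1 hx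
  constructor
  · intro hT'
    by_cases hvr : v ∈ Set.range u
    · obtain ⟨i, rfl⟩ := hvr
      exact Or.inr ⟨⟨i, rfl⟩, (hu.degreeOn_eq_two_iff i).2 fun w hw hwr =>
        hu.eq_succ_or_pred hT i hT' hw hwr⟩
    · exact Or.inl ⟨⟨hv, hvr⟩, hT.degree_eq_three hT' hv fun hvO => hvr ((hr hv).2 hvO)⟩
  · rintro (⟨⟨-, hvr⟩, hd⟩ | ⟨hvr, hd⟩)
    · exact hT.deleteVerts_interior hn hv (fun hvO => hvr ((hr hv).2 hvO)) hd
    · obtain ⟨i, rfl⟩ := hvr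
      refine hT.deleteVerts_boundary hn hv ((hr hv).1 ⟨i, rfl⟩) fun x hx hxO => ?_
      rcases (hu.degreeOn_eq_two_iff i).1 hd x hx ((hr (T.mem_of_adj _ _ hx).2).2 hxO) with
        rfl | rfl
      · exact hu.segment_succ_subset i
      · exact hu.segment_pred_subset i
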